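/- For 3 ≤ N ≤ 25, the lattice Λ_N = U² ⊕ D_{N-2} admits a saturated (primitive) embedding into the even unimodular lattice II_{2,26} with orthogonal complement isomorphic to D_{26-N}; and for 3 ≤ N ≤ 17 it also admits a saturated embedding with orthogonal complement isomorphic to E₈ ⊕ D_{18-N}. Conversely, the orthogonal complement of any saturated embedding of D_{26-N} (respectively E₈ ⊕ D_{18-N}) into II_{2,26} is isomorphic to Λ_N. -/

import Mathlib

noncomputable section

open scoped BigOperators

/-- `x` has integer entries. -/
def IntVec {n : ℕ} (x : Fin n → ℚ) : Prop := ∀ i, ∃ a : ℤ, x i = (a : ℚ)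

/-- The lattice `D_n = {x ∈ ℤⁿ : Σ xᵢ ≡ 0 mod 2}` (viewed inside `ℚⁿ`),
equipped with the negative of the Euclidean form `negE`. -/
def DSet (n : ℕ) : Set (Fin n → ℚ) :=
  {x | IntVec x ∧ ∃ a : ℤ, (∑ i, x i) = 2 * (a : ℚ)}

/-- The negative of the standard Euclidean bilinear form. -/
def negE {n : ℕ} (x y : Fin n → ℚ) : ℚ := - ∑ i, x i * y i

/-- The vector `(1/2, …, 1/2)`. -/
def halfVec (n : ℕ) : Fin n → ℚ := fun _ => 1/2

/-- The lattice `Λ_N = U² ⊕ D_{N-2}` realized inside `ℚ^{N+2}`: integral vectors whose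
coordinates of index `≥ 4` have even sum.  The first four coordinates carry the two
hyperbolic planes. -/
def LamSet (N : ℕ) : Set (Fin (N + 2) → ℚ) :=
  {x | IntVec x ∧ ∃ a : ℤ, (∑ i : Fin (N + 2), if 4 ≤ (i : ℕ) then x i else 0) = 2 * (a : ℚ)}

/-- The bilinear form of `Λ_N = U² ⊕ D_{N-2}`. -/
def LamForm (N : ℕ) (x y : Fin (N + 2) → ℚ) : ℚ :=
  x 0 * y 1 + x 1 * y 0 + x 2 * y 3 + x 3 * y 2
    - ∑ i : Fin (N + 2), (if 4 ≤ (i : ℕ) then x i * y i else 0)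

/-- The (negative definite) `E₈` lattice inside `ℚ⁸`: vectors that are integral or
half-integral, with even coordinate sum; the form is `negE`. -/
def E8Set : Set (Fin 8 → ℚ) :=
  {x | (IntVec x ∨ IntVec (x - halfVec 8)) ∧ ∃ a : ℤ, (∑ i, x i) = 2 * (a : ℚ)}

/-- Ambient space for the even unimodular lattice `II_{2,2+8k} = U² ⊕ E₈^k`. -/
abbrev IIAmb (k : ℕ) := (Fin 4 → ℚ) × (Fin k → Fin 8 → ℚ)

/-- The form of `U²` on `ℚ⁴`. -/
def UForm (x y : Fin 4 → ℚ) : ℚ := x 0 * y 1 + x 1 * y 0 + x 2 * y 3 + x 3 * y 2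

/-- The bilinear form of `II_{2,2+8k} = U² ⊕ E₈^k`. -/
def IIForm (k : ℕ) (x y : IIAmb k) : ℚ := UForm x.1 y.1 + ∑ j, negE (x.2 j) (y.2 j)

/-- The even unimodular lattice `II_{2,2+8k} = U² ⊕ E₈^k` inside its ambient space. -/
def IISet (k : ℕ) : Set (IIAmb k) := {p | IntVec p.1 ∧ ∀ j, p.2 j ∈ E8Set}

/-- `v` has divisibility `d` in `Λ_N`: all pairings with lattice vectors are divisible
by `d`, and `d` is attained. -/
def HasDiv (N : ℕ) (v : Fin (N + 2) → ℚ) (d : ℤ) : Prop :=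
  (∀ x ∈ LamSet N, ∃ a : ℤ, LamForm N v x = (d : ℚ) * a) ∧
  ∃ x ∈ LamSet N, LamForm N v x = (d : ℚ)

/-- `ξ` represents a decoration of `Λ_N`: an element of the dual lattice whose class in
the discriminant group has square `1` modulo `2ℤ`. -/
def IsDeco (N : ℕ) (ξ : Fin (N + 2) → ℚ) : Prop :=
  (∀ y ∈ LamSet N, ∃ a : ℤ, LamForm N ξ y = (a : ℚ)) ∧
  ∃ a : ℤ, LamForm N ξ ξ = 1 + 2 * (a : ℚ)

/-- `r` is an integer. -/
def ZZ (r : ℚ) : Prop := ∃ a : ℤ, r = (a : ℚ)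

theorem ZZ.add {r s : ℚ} (h : ZZ r) (k : ZZ s) : ZZ (r + s) := by
  obtain ⟨a, rfl⟩ := h; obtain ⟨b, rfl⟩ := k; exact ⟨a + b, by push_cast; rfl⟩
theorem ZZ.sub {r s : ℚ} (h : ZZ r) (k : ZZ s) : ZZ (r - s) := by
  obtain ⟨a, rfl⟩ := h; obtain ⟨b, rfl⟩ := k; exact ⟨a - b, by push_cast; rfl⟩
theorem ZZ.mul {r s : ℚ} (h : ZZ r) (k : ZZ s) : ZZ (r * s) := by
  obtain ⟨a, rfl⟩ := h; obtain ⟨b, rfl⟩ := k; exact ⟨a * b, by push_cast; rfl⟩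
theorem ZZ.neg {r : ℚ} (h : ZZ r) : ZZ (-r) := by
  obtain ⟨a, rfl⟩ := h; exact ⟨-a, by push_cast; rfl⟩
theorem ZZ.int (a : ℤ) : ZZ (a : ℚ) := ⟨a, rfl⟩
theorem ZZ.zero : ZZ 0 := ⟨0, by simp⟩
theorem ZZ.one : ZZ 1 := ⟨1, by simp⟩
theorem ZZ.sum {ι : Type*} (s : Finset ι) (f : ι → ℚ) (h : ∀ i ∈ s, ZZ (f i)) :
    ZZ (∑ i ∈ s, f i) := by
  classical
  induction s using Finset.induction_on with
  | empty => simpa using ZZ.zero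
  | insert a s ha ih =>
    rw [Finset.sum_insert ha]
    exact (h a (by simp)).add (ih fun i hi => h i (by simp [hi]))

section Eichler
variable {V : Type*} [AddCommGroup V] [Module ℚ V]

/-- The Eichler transvection. -/
def transvMap (B : LinearMap.BilinForm ℚ V) (e a : V) : V →ₗ[ℚ] V :=
  LinearMap.id - (B a).smulRight e + (B e).smulRight a - (B a a / 2) • (B e).smulRight e

theorem transvMap_apply (B : LinearMap.BilinForm ℚ V) (e a x : V) :
    transvMap B e a x = x - B a x • e + B e x • a - (B a a / 2 * B e x) • e := by
  simp [transvMap, mul_smul]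

theorem transvMap_inv (B : LinearMap.BilinForm ℚ V) (hs : ∀ x y, B x y = B y x) (e a : V)
    (he : B e e = 0) (hea : B e a = 0) (x : V) :
    transvMap B e (-a) (transvMap B e a x) = x := by
  have hae : B a e = 0 := by rw [hs, hea]
  simp only [transvMap_apply, map_add, map_sub, map_smul, map_neg, LinearMap.neg_apply,
    smul_eq_mul, he, hea, hae]
  module

/-- The Eichler transvection as an equivalence. -/
def transv (B : LinearMap.BilinForm ℚ V) (hs : ∀ x y, B x y = B y x) (e a : V)
    (he : B e e = 0) (hea : B e a = 0) : V ≃ₗ[ℚ] V :=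
  LinearEquiv.ofLinearMap (transvMap B e a) (transvMap B e (-a))
    (by
      ext x
      have := transvMap_inv B hs e (-a) he (by simp [hea]) x
      simpa using this)
    (by
      ext x
      simpa using transvMap_inv B hs e a he hea x)

theorem transv_apply (B : LinearMap.BilinForm ℚ V) (hs : ∀ x y, B x y = B y x) (e a : V)
    (he : B e e = 0) (hea : B e a = 0) (x : V) :
    transv B hs e a he hea x = x - B a x • e + B e x • a - (B a a / 2 * B e x) • e :=
  transvMap_apply B e a x

/-- Isometries acting trivially on the dual of `K` modulo `K` and on the complement of `K`. -/
def Good (B : LinearMap.BilinForm ℚ V) (K : AddSubgroup V) (φ : V ≃ₗ[ℚ] V) : Prop :=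
  (∀ x y, B (φ x) (φ y) = B x y) ∧
  (∀ x, (∀ a ∈ K, ZZ (B x a)) → φ x - x ∈ K) ∧
  (∀ x, (∀ a ∈ K, B x a = 0) → φ x = x)

theorem smul_mem_of_ZZ {K : AddSubgroup V} {r : ℚ} (hr : ZZ r) {x : V} (hx : x ∈ K) :
    r • x ∈ K := by
  obtain ⟨n, rfl⟩ := hr
  rw [Int.cast_smul_eq_zsmul]
  exact K.zsmul_mem hx n

variable {B : LinearMap.BilinForm ℚ V} {K : AddSubgroup V}

theorem Good.memK (hIntg : ∀ x ∈ K, ∀ y ∈ K, ZZ (B x y)) {φ : V ≃ₗ[ℚ] V} (h : Good B K φ)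
    {a : V} (ha : a ∈ K) : φ a ∈ K := by
  have := K.add_mem (h.2.1 a (hIntg a ha)) ha
  simpa using this

theorem Good.refl : Good B K (LinearEquiv.refl ℚ V) :=
  ⟨fun _ _ => rfl, fun x _ => by simp, fun _ _ => rfl⟩

theorem Good.symm (hIntg : ∀ x ∈ K, ∀ y ∈ K, ZZ (B x y)) {φ : V ≃ₗ[ℚ] V} (h : Good B K φ) :
    Good B K φ.symm := by
  refine ⟨fun x y => ?_, fun x hx => ?_, fun x hx => ?_⟩
  · rw [← h.1]; simp
  · have h1 := h.2.1 (φ.symm x) (fun a ha => by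
      rw [← h.1]; simpa using hx _ (h.memK hIntg ha))
    have := K.neg_mem h1
    simpa using this
  · rw [LinearEquiv.symm_apply_eq]
    exact (h.2.2 x hx).symm

theorem Good.dual (hIntg : ∀ x ∈ K, ∀ y ∈ K, ZZ (B x y)) {φ : V ≃ₗ[ℚ] V}
    (h : Good B K φ) {x : V} (hx : ∀ a ∈ K, ZZ (B x a)) : ∀ a ∈ K, ZZ (B (φ x) a) := by
  intro a ha
  have h1 : φ x = (φ x - x) + x := by abel
  rw [h1, map_add, LinearMap.add_apply]
  exact (hIntg _ (h.2.1 x hx) a ha).add (hx a ha)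

theorem Good.trans (hIntg : ∀ x ∈ K, ∀ y ∈ K, ZZ (B x y)) {φ ψ : V ≃ₗ[ℚ] V}
    (h : Good B K φ) (k : Good B K ψ) : Good B K (φ.trans ψ) := by
  refine ⟨fun x y => ?_, fun x hx => ?_, fun x hx => ?_⟩
  · simp [h.1, k.1]
  · have h1 := k.2.1 (φ x) (h.dual hIntg hx)
    have := K.add_mem h1 (h.2.1 x hx)
    simpa using this
  · simp [h.2.2 x hx, k.2.2 x hx]

theorem Good.transv (hs : ∀ x y, B x y = B y x)
    (hev : ∀ x ∈ K, ∃ n : ℤ, B x x = 2 * (n : ℚ)) {e a : V} (heK : e ∈ K) (haK : a ∈ K)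
    (he : B e e = 0) (hea : B e a = 0) : Good B K (transv B hs e a he hea) := by
  have hae : B a e = 0 := by rw [hs, hea]
  refine ⟨fun x y => ?_, fun x hx => ?_, fun x hx => ?_⟩
  · simp only [transv_apply, map_add, map_sub, map_smul, LinearMap.add_apply,
      LinearMap.sub_apply, LinearMap.smul_apply, smul_eq_mul, he, hea, hae, hs x e, hs x a]
    ring
  · rw [transv_apply]
    obtain ⟨n, hn⟩ := hev a haK
    have h1 : ZZ (B a x) := by rw [hs]; exact hx a haK
    have h2 : ZZ (B e x) := by rw [hs]; exact hx e heK
    have h3 : ZZ (B a a / 2 * B e x) := by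
      rw [hn]
      refine ZZ.mul ⟨n, by ring⟩ h2
    have : x - B a x • e + B e x • a - (B a a / 2 * B e x) • e - x =
      B e x • a - B a x • e - (B a a / 2 * B e x) • e := by abel
    rw [this]
    exact K.sub_mem (K.sub_mem (smul_mem_of_ZZ h2 haK) (smul_mem_of_ZZ h1 heK))
      (smul_mem_of_ZZ h3 heK)
  · rw [transv_apply, hs a x, hs e x, hx a haK, hx e heK]
    simp

/-- Euclidean step: a minimal value divides the adjacent value. -/
theorem eichler_div (hs : ∀ x y, B x y = B y x)
    (hIntg : ∀ x ∈ K, ∀ y ∈ K, ZZ (B x y))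
    (hev : ∀ x ∈ K, ∃ n : ℤ, B x x = 2 * (n : ℚ))
    {e1 f1 e2 f2 : V} (he1 : e1 ∈ K) (hf1 : f1 ∈ K) (he2 : e2 ∈ K) (hf2 : f2 ∈ K)
    (h11 : B e1 e1 = 0) (h22 : B f1 f1 = 0) (h33 : B e2 e2 = 0) (h44 : B f2 f2 = 0)
    (h12 : B e1 f1 = 1) (h34 : B e2 f2 = 1) (h13 : B e1 e2 = 0) (h14 : B e1 f2 = 0)
    (h23 : B f1 e2 = 0) (h24 : B f1 f2 = 0)
    {v : V} (d : ℕ) (hd : 0 < d)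
    (hmin : ∀ (n : ℕ) (φ : V ≃ₗ[ℚ] V), 0 < n → Good B K φ → B (φ v) f2 = (n : ℚ) → d ≤ n)
    (φ : V ≃ₗ[ℚ] V) (hφ : Good B K φ) (hφd : B (φ v) f2 = (d : ℚ)) (al : ℤ)
    (hal : B (φ v) f1 = (al : ℚ)) : (d : ℤ) ∣ al := by
  by_contra hnd
  have hdz : (0 : ℤ) < d := by exact_mod_cast hd
  have hmod : al % (d : ℤ) ≠ 0 := fun h => hnd (Int.dvd_of_emod_eq_zero h)
  have h0 := Int.emod_nonneg al hdz.ne'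
  have h1 := Int.emod_lt_of_pos al hdz
  have h2 := Int.emod_add_mul_ediv al (d : ℤ)
  set r := al % (d : ℤ) with hr
  set c : ℚ := ((-(al / (d : ℤ)) : ℤ) : ℚ) with hc
  have hcK : c • e1 ∈ K := smul_mem_of_ZZ ⟨_, rfl⟩ he1
  have hh14 : B f2 e1 = 0 := by rw [hs, h14]
  have hh32 : B e2 f1 = 0 := by rw [hs, h23]
  have hp1 : B f2 (c • e1) = 0 := by simp [hh14]
  have g1 := Good.transv hs hev hf2 hcK h44 hp1
  have g2 := Good.transv hs hev he2 hf1 h33 hh32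
  set T1 := _root_.transv B hs f2 (c • e1) h44 hp1
  set T2 := _root_.transv B hs e2 f1 h33 hh32
  set x := φ v with hx
  have a1 : B (T1 x) f1 = (r : ℚ) := by
    simp only [T1, transv_apply, map_add, map_sub, map_smul, LinearMap.add_apply,
      LinearMap.sub_apply, LinearMap.smul_apply, smul_eq_mul, h12, hs f2 f1, h24, h11,
      hs f2 x, hφd, hal]
    have : (al : ℚ) = r + d * ((al / (d : ℤ) : ℤ) : ℚ) := by exact_mod_cast h2.symm
    rw [this, hc]; push_cast; ring
  have a2 : B (T1 x) f2 = (d : ℚ) := by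
    simp only [T1, transv_apply, map_add, map_sub, map_smul, LinearMap.add_apply,
      LinearMap.sub_apply, LinearMap.smul_apply, smul_eq_mul, h14, h44, hφd]
    ring
  have a3 : B (T2 (T1 x)) f2 = ((d : ℤ) - r : ℤ) := by
    generalize T1 x = y at a1 a2
    simp only [T2, transv_apply, map_add, map_sub, map_smul, LinearMap.add_apply,
      LinearMap.sub_apply, LinearMap.smul_apply, smul_eq_mul, h24, h34, h22, a2, hs f1 y, a1]
    push_cast; ring
  obtain ⟨n, hn⟩ : ∃ n : ℕ, (n : ℤ) = d - r := ⟨((d : ℤ) - r).toNat, by omega⟩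
  have := hmin n ((φ.trans T1).trans T2) (by omega) ((hφ.trans hIntg g1).trans hIntg g2)
    (by simp only [LinearEquiv.trans_apply]; rw [← hx, a3, ← hn]; simp)
  omega

theorem eichler_unit (hs : ∀ x y, B x y = B y x)
    (hIntg : ∀ x ∈ K, ∀ y ∈ K, ZZ (B x y))
    (hev : ∀ x ∈ K, ∃ n : ℤ, B x x = 2 * (n : ℚ))
    {e1 f1 e2 f2 : V} (he1 : e1 ∈ K) (hf1 : f1 ∈ K) (he2 : e2 ∈ K) (hf2 : f2 ∈ K)
    (h11 : B e1 e1 = 0) (h22 : B f1 f1 = 0) (h33 : B e2 e2 = 0) (h44 : B f2 f2 = 0)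
    (h12 : B e1 f1 = 1) (h34 : B e2 f2 = 1) (h13 : B e1 e2 = 0) (h14 : B e1 f2 = 0)
    (h23 : B f1 e2 = 0) (h24 : B f1 f2 = 0)
    {v : V} (hv : ∀ a ∈ K, ZZ (B v a)) (h1 : ∃ a ∈ K, B v a = 1) :
    ∃ φ : V ≃ₗ[ℚ] V, Good B K φ ∧ B (φ v) f2 = 1 := by
  have hh14 : B f2 e1 = 0 := by rw [hs, h14]
  have hh24 : B f2 f1 = 0 := by rw [hs, h24]
  have hh32 : B e2 f1 = 0 := by rw [hs, h23]
  have hh31 : B e2 e1 = 0 := by rw [hs, h13]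
  have hh21 : B f1 e1 = 1 := by rw [hs, h12]
  -- a divisor with the right property
  have key : ∃ d : ℕ, (∃ φ : V ≃ₗ[ℚ] V, Good B K φ ∧ B (φ v) f2 = (d : ℚ)) ∧
      ∀ φ : V ≃ₗ[ℚ] V, Good B K φ → B (φ v) f2 = (d : ℚ) → ∀ al : ℤ,
        (B (φ v) f1 = (al : ℚ) ∨ B (φ v) e1 = (al : ℚ)) → (d : ℤ) ∣ al := by
    classical
    by_cases hex : ∃ n : ℕ, 0 < n ∧ ∃ φ : V ≃ₗ[ℚ] V, Good B K φ ∧ B (φ v) f2 = (n : ℚ)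
    · obtain ⟨hpos, φ0, hφ0, hφ0d⟩ := Nat.find_spec hex
      have hmin : ∀ (n : ℕ) (φ : V ≃ₗ[ℚ] V), 0 < n → Good B K φ → B (φ v) f2 = (n : ℚ) →
          Nat.find hex ≤ n := fun n φ h1 h2 h3 => Nat.find_min' hex ⟨h1, φ, h2, h3⟩
      refine ⟨Nat.find hex, ⟨φ0, hφ0, hφ0d⟩, fun φ hφ hφd al hal => ?_⟩
      rcases hal with hal | hal
      · exact eichler_div hs hIntg hev he1 hf1 he2 hf2 h11 h22 h33 h44 h12 h34 h13 h14 h23 h24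
          _ hpos hmin φ hφ hφd al hal
      · exact eichler_div hs hIntg hev hf1 he1 he2 hf2 h22 h11 h33 h44 hh21 h34 h23 h24 h13 h14
          _ hpos hmin φ hφ hφd al hal
    · -- all values vanish
      have hneg : ∀ φ : V ≃ₗ[ℚ] V, Good B K φ → ∀ n : ℤ, B (φ v) f2 = (n : ℚ) → n ≤ 0 := by
        intro φ hφ n hn
        by_contra hlt
        exact hex ⟨n.toNat, by omega, φ, hφ, by
          rw [hn]
          have : ((n.toNat : ℤ) : ℚ) = n := by rw [Int.toNat_of_nonneg (by omega)]
          rw [← this, Int.cast_natCast]⟩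
      have hstep : ∀ φ : V ≃ₗ[ℚ] V, Good B K φ → ∀ f ∈ K, B f f = 0 → B e2 f = 0 → B f f2 = 0 →
          ∀ ga al : ℤ, B (φ v) f2 = (ga : ℚ) → B (φ v) f = (al : ℚ) → ∀ t : ℤ,
            ga - t * al ≤ 0 := by
        intro φ hφ f hf hff he2f hff2 ga al hga hal t
        have htK : (t : ℚ) • f ∈ K := smul_mem_of_ZZ ⟨t, rfl⟩ hf
        have hp : B e2 ((t : ℚ) • f) = 0 := by simp [he2f]
        have g := Good.transv hs hev he2 htK h33 hp
        refine hneg _ (hφ.trans hIntg g) _ ?_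
        generalize hx : φ v = x at *
        simp only [LinearEquiv.trans_apply, hx, transv_apply, map_add, map_sub, map_smul,
          LinearMap.add_apply, LinearMap.sub_apply, LinearMap.smul_apply, smul_eq_mul, h34,
          hff2, hff, hga, hs f x, hal]
        push_cast; ring
      have hz : ∀ φ : V ≃ₗ[ℚ] V, Good B K φ → ∀ f ∈ K, B f f = 0 → B e2 f = 0 → B f f2 = 0 →
          ∀ al : ℤ, B (φ v) f = (al : ℚ) → al = 0 := by
        intro φ hφ f hf hff he2f hff2 al hal
        obtain ⟨ga, hga⟩ := hφ.dual hIntg hv f2 hf2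
        have k := hstep φ hφ f hf hff he2f hff2 ga al hga hal
        by_contra hne
        have k1 := k ((ga - 1) * al)
        have : 0 < al * al := mul_self_pos.mpr hne
        have k2 := hneg φ hφ ga hga
        nlinarith
      refine ⟨0, ⟨LinearEquiv.refl ℚ V, Good.refl, ?_⟩, ?_⟩
      · obtain ⟨ga, hga⟩ := hv f2 hf2
        obtain ⟨al, hal⟩ := hv f1 hf1
        have g := Good.transv hs hev hf2 he1 h44 hh14
        have z0 := hz _ Good.refl f1 hf1 h22 hh32 h24 al (by simpa using hal)
        have z1 := hz _ g f1 hf1 h22 hh32 h24 (al + ga) (by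
          simp only [transv_apply, map_add, map_sub, map_smul, LinearMap.add_apply,
            LinearMap.sub_apply, LinearMap.smul_apply, smul_eq_mul, h12, hh24, h11,
            hs f2 v, hga, hal]
          push_cast; ring)
        have : ga = 0 := by omega
        simp [hga, this]
      · intro φ hφ _ al hal
        rcases hal with hal | hal
        · simp [hz φ hφ f1 hf1 h22 hh32 h24 al hal]
        · simp [hz φ hφ e1 he1 h11 hh31 h14 al hal]
  obtain ⟨d, ⟨φ0, hφ0, hφ0d⟩, hdiv⟩ := key
  -- normalise the value at `e1` to zero
  have hzero : ∃ φ : V ≃ₗ[ℚ] V, Good B K φ ∧ B (φ v) f2 = (d : ℚ) ∧ B (φ v) e1 = 0 := by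
    obtain ⟨be, hbe⟩ := hφ0.dual hIntg hv e1 he1
    obtain ⟨c, hc⟩ := hdiv φ0 hφ0 hφ0d be (Or.inr hbe)
    have hcK : ((-c : ℤ) : ℚ) • f1 ∈ K := smul_mem_of_ZZ ⟨_, rfl⟩ hf1
    have hp : B f2 (((-c : ℤ) : ℚ) • f1) = 0 := by rw [map_smul, hh24, smul_zero]
    have g := Good.transv hs hev hf2 hcK h44 hp
    refine ⟨_, hφ0.trans hIntg g, ?_, ?_⟩
    · generalize hx : φ0 v = x at *
      simp only [LinearEquiv.trans_apply, hx, transv_apply, map_add, map_sub, map_smul,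
        LinearMap.add_apply, LinearMap.sub_apply, LinearMap.smul_apply, smul_eq_mul, h44, h24,
        hφ0d]
      ring
    · generalize hx : φ0 v = x at *
      simp only [LinearEquiv.trans_apply, hx, transv_apply, map_add, map_sub, map_smul,
        LinearMap.add_apply, LinearMap.sub_apply, LinearMap.smul_apply, smul_eq_mul, h22, hh14,
        hh21, hs f2 x, hφ0d, hbe, hc]
      push_cast; ring
  obtain ⟨φ, hφ, hφd, hφ1⟩ := hzero
  have hperp : ∀ a ∈ K, B e1 a = 0 → ∀ n : ℤ, B (φ v) a = (n : ℚ) → (d : ℤ) ∣ n := by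
    intro a ha hea n hn
    obtain ⟨al, hal⟩ := hφ.dual hIntg hv f1 hf1
    have g := Good.transv hs hev he1 ha h11 hea
    have d1 := hdiv φ hφ hφd al (Or.inl hal)
    have d2 := hdiv _ (hφ.trans hIntg g) (by
      generalize hx : φ v = x at *
      simp only [LinearEquiv.trans_apply, hx, transv_apply, map_add, map_sub, map_smul,
        LinearMap.add_apply, LinearMap.sub_apply, LinearMap.smul_apply, smul_eq_mul, h14,
        hs e1 x, hφ1, hφd]
      ring) (al - n) (Or.inl (by
      generalize hx : φ v = x at *
      simp only [LinearEquiv.trans_apply, hx, transv_apply, map_add, map_sub, map_smul,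
        LinearMap.add_apply, LinearMap.sub_apply, LinearMap.smul_apply, smul_eq_mul, h12,
        hs e1 x, hs a x, hφ1, hal, hn]
      push_cast; ring))
    have := dvd_sub d1 d2
    simpa using this
  have hall : ∀ a ∈ K, ∀ n : ℤ, B (φ v) a = (n : ℚ) → (d : ℤ) ∣ n := by
    intro a ha n hn
    obtain ⟨m, hm⟩ := hIntg e1 he1 a ha
    obtain ⟨al, hal⟩ := hφ.dual hIntg hv f1 hf1
    have d1 := hdiv φ hφ hφd al (Or.inl hal)
    have d2 := hperp (a - (m : ℚ) • f1) (K.sub_mem ha (smul_mem_of_ZZ ⟨m, rfl⟩ hf1))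
      (by simp [hm, h12]) (n - m * al) (by simp [hn, hal])
    have := dvd_add d2 (d1.mul_left m)
    simpa using this
  obtain ⟨a0, ha0, hva0⟩ := h1
  have hd1 : (d : ℤ) ∣ 1 := hall (φ a0) (hφ.memK hIntg ha0) 1 (by rw [hφ.1, hva0]; simp)
  have hd : d = 1 := by
    have := Int.natCast_dvd_natCast.mp (by simpa using hd1 : (d : ℤ) ∣ ((1 : ℕ) : ℤ))
    simpa using this
  exact ⟨φ, hφ, by rw [hφd, hd]; simp⟩

/-- Eichler's criterion. -/
theorem eichler (hs : ∀ x y, B x y = B y x)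
    (hIntg : ∀ x ∈ K, ∀ y ∈ K, ZZ (B x y))
    (hev : ∀ x ∈ K, ∃ n : ℤ, B x x = 2 * (n : ℚ))
    {e1 f1 e2 f2 : V} (he1 : e1 ∈ K) (hf1 : f1 ∈ K) (he2 : e2 ∈ K) (hf2 : f2 ∈ K)
    (h11 : B e1 e1 = 0) (h22 : B f1 f1 = 0) (h33 : B e2 e2 = 0) (h44 : B f2 f2 = 0)
    (h12 : B e1 f1 = 1) (h34 : B e2 f2 = 1) (h13 : B e1 e2 = 0) (h14 : B e1 f2 = 0)
    (h23 : B f1 e2 = 0) (h24 : B f1 f2 = 0)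
    {v w : V} (hv : ∀ a ∈ K, ZZ (B v a)) (h1 : ∃ a ∈ K, B v a = 1)
    (hw : ∀ a ∈ K, ZZ (B w a)) (k1 : ∃ a ∈ K, B w a = 1)
    (hd : v - w ∈ K) (hn : B v v = B w w) :
    ∃ φ : V ≃ₗ[ℚ] V, Good B K φ ∧ φ v = w := by
  obtain ⟨φ, hφ, hφ1⟩ := eichler_unit hs hIntg hev he1 hf1 he2 hf2 h11 h22 h33 h44 h12 h34 h13
    h14 h23 h24 hv h1
  obtain ⟨ψ, hψ, hψ1⟩ := eichler_unit hs hIntg hev he1 hf1 he2 hf2 h11 h22 h33 h44 h12 h34 h13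
    h14 h23 h24 hw k1
  have haK : ψ w - φ v ∈ K := by
    have := K.sub_mem (K.sub_mem (hψ.2.1 w hw) (hφ.2.1 v hv)) hd
    have e : ψ w - φ v = ψ w - w - (φ v - v) - (v - w) := by abel
    rw [e]; exact this
  have hp : B f2 (ψ w - φ v) = 0 := by rw [hs]; simp [hφ1, hψ1]
  have g := Good.transv hs hev hf2 haK h44 hp
  have hφv : B (φ v) (φ v) = B (ψ w) (ψ w) := by rw [hφ.1, hψ.1, hn]
  refine ⟨(φ.trans (_root_.transv B hs f2 (ψ w - φ v) h44 hp)).trans ψ.symm,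
    (hφ.trans hIntg g).trans hIntg (hψ.symm hIntg), ?_⟩
  simp only [LinearEquiv.trans_apply]
  rw [LinearEquiv.symm_apply_eq, transv_apply]
  generalize φ v = x at *
  generalize ψ w = y at *
  rw [hs f2 x, hφ1]
  have : B (y - x) x + B (y - x) (y - x) / 2 = 0 := by
    simp only [map_sub, LinearMap.sub_apply]
    rw [hs x y]
    linarith
  have e : x - (B (y - x)) x • f2 + (1 : ℚ) • (y - x) - ((B (y - x)) (y - x) / 2 * 1) • f2 =
    y - (B (y - x) x + B (y - x) (y - x) / 2) • f2 := by module
  rw [e, this]; simp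
end Eichler

set_option linter.unusedSectionVars false
section Model

/-- Ambient space of `U² ⊕ ℤ^ι`. -/
abbrev VV (ι : Type) := (Fin 4 → ℚ) × (ι → ℚ)

variable {ι κ : Type} [Fintype ι] [Fintype κ]

/-- The form on the model space. -/
def BV (ι : Type) [Fintype ι] : LinearMap.BilinForm ℚ (VV ι) :=
  LinearMap.mk₂ ℚ (fun x y => UForm x.1 y.1 - ∑ i, x.2 i * y.2 i)
    (by intro x y z; simp [UForm, add_mul, Finset.sum_add_distrib]; ring)
    (by intro c x y; simp [UForm, mul_assoc, ← Finset.mul_sum]; ring)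
    (by intro x y z; simp [UForm, mul_add, Finset.sum_add_distrib]; ring)
    (by intro c x y; simp [UForm, mul_left_comm, ← Finset.mul_sum]; ring)

theorem BV_apply (x y : VV ι) : BV ι x y = UForm x.1 y.1 - ∑ i, x.2 i * y.2 i := rfl

theorem BV_symm (x y : VV ι) : BV ι x y = BV ι y x := by
  rw [BV_apply, BV_apply, Finset.sum_congr rfl fun i _ => mul_comm (x.2 i) (y.2 i)]
  simp only [UForm]; ring

/-- The lattice `D_n⁺`. -/
def Dp (ι : Type) [Fintype ι] : AddSubgroup (ι → ℚ) where
  carrier := {x | ((∀ i, ZZ (x i)) ∨ (∀ i, ZZ (x i - 1 / 2))) ∧ ∃ a : ℤ, ∑ i, x i = 2 * (a : ℚ)}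
  zero_mem' := ⟨Or.inl fun _ => ZZ.zero, 0, by simp⟩
  add_mem' := by
    rintro x y ⟨hx, a, ha⟩ ⟨hy, b, hb⟩
    refine ⟨?_, a + b, by simp [Finset.sum_add_distrib, ha, hb]; ring⟩
    rcases hx with hx | hx <;> rcases hy with hy | hy
    · exact Or.inl fun i => (hx i).add (hy i)
    · refine Or.inr fun i => ?_
      have := (hx i).add (hy i)
      rwa [← add_sub_assoc] at this
    · refine Or.inr fun i => ?_
      have := (hx i).add (hy i)
      have e : (x + y) i - 1 / 2 = x i - 1 / 2 + y i := by simp; ring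
      rwa [e]
    · refine Or.inl fun i => ?_
      have := ((hx i).add (hy i)).add ZZ.one
      have e : (x + y) i = x i - 1 / 2 + (y i - 1 / 2) + 1 := by simp; ring
      rwa [e]
  neg_mem' := by
    rintro x ⟨hx, a, ha⟩
    refine ⟨?_, -a, by simp [ha]⟩
    rcases hx with hx | hx
    · exact Or.inl fun i => (hx i).neg
    · refine Or.inr fun i => ?_
      have := ((hx i).neg).sub ZZ.one
      have e : (-x) i - 1 / 2 = -(x i - 1 / 2) - 1 := by simp; ring
      rwa [e]

theorem mem_Dp {x : ι → ℚ} : x ∈ Dp ι ↔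
    ((∀ i, ZZ (x i)) ∨ (∀ i, ZZ (x i - 1 / 2))) ∧ ∃ a : ℤ, ∑ i, x i = 2 * (a : ℚ) := Iff.rfl

/-- The lattice `U² ⊕ D_n⁺`. -/
def L1 (ι : Type) [Fintype ι] : AddSubgroup (VV ι) where
  carrier := {x | (∀ i, ZZ (x.1 i)) ∧ x.2 ∈ Dp ι}
  zero_mem' := ⟨fun _ => ZZ.zero, (Dp ι).zero_mem⟩
  add_mem' := fun h k => ⟨fun i => (h.1 i).add (k.1 i), (Dp ι).add_mem h.2 k.2⟩
  neg_mem' := fun h => ⟨fun i => (h.1 i).neg, (Dp ι).neg_mem h.2⟩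

theorem mem_L1 {x : VV ι} : x ∈ L1 ι ↔ (∀ i, ZZ (x.1 i)) ∧ x.2 ∈ Dp ι := Iff.rfl

theorem int_sq_add (a : ℤ) : ∃ b : ℤ, a * a = a + 2 * b := by
  obtain ⟨b, hb⟩ := Int.even_mul_pred_self a
  exact ⟨b, by linarith⟩

theorem Dp_even (h8 : 8 ∣ Fintype.card ι) {x : ι → ℚ} (hx : x ∈ Dp ι) :
    ∃ n : ℤ, ∑ i, x i * x i = 2 * (n : ℚ) := by
  obtain ⟨m, hm⟩ := h8
  obtain ⟨h, s, hsum⟩ := hx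
  choose b hb using int_sq_add
  rcases h with h | h
  · choose a ha using h
    refine ⟨s + ∑ i, b (a i), ?_⟩
    push_cast
    rw [mul_add, ← hsum, Finset.mul_sum, ← Finset.sum_add_distrib]
    refine Finset.sum_congr rfl fun i _ => ?_
    rw [ha i]; exact_mod_cast hb (a i)
  · choose a ha using h
    refine ⟨2 * s - 3 * m + ∑ i, b (a i), ?_⟩
    have e : ∀ i, x i * x i = 2 * x i + 2 * (b (a i) : ℚ) + (-(3 / 4) : ℚ) := by
      intro i
      have h1 : x i = a i + 1 / 2 := by linarith [ha i]
      have h2 : (a i : ℚ) * a i = a i + 2 * b (a i) := by exact_mod_cast hb (a i)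
      rw [h1]; linarith
    rw [Finset.sum_congr rfl fun i _ => e i, Finset.sum_add_distrib, Finset.sum_add_distrib,
      ← Finset.mul_sum, ← Finset.mul_sum, hsum]
    simp only [Finset.sum_const, Finset.card_univ, hm, nsmul_eq_mul]
    push_cast; ring

theorem L1_even (h8 : 8 ∣ Fintype.card ι) {x : VV ι} (hx : x ∈ L1 ι) :
    ∃ n : ℤ, BV ι x x = 2 * (n : ℚ) := by
  obtain ⟨n, hn⟩ := Dp_even h8 hx.2
  choose a ha using hx.1
  refine ⟨a 0 * a 1 + a 2 * a 3 - n, ?_⟩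
  rw [BV_apply, hn, UForm, ha 0, ha 1, ha 2, ha 3]
  push_cast; ring

theorem int_of_even {V : Type*} [AddCommGroup V] [Module ℚ V] {B : LinearMap.BilinForm ℚ V}
    (hs : ∀ x y, B x y = B y x) {L : AddSubgroup V}
    (h : ∀ x ∈ L, ∃ n : ℤ, B x x = 2 * (n : ℚ)) : ∀ x ∈ L, ∀ y ∈ L, ZZ (B x y) := by
  intro x hx y hy
  obtain ⟨a, ha⟩ := h x hx
  obtain ⟨b, hb⟩ := h y hy
  obtain ⟨c, hc⟩ := h (x + y) (L.add_mem hx hy)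
  refine ⟨c - a - b, ?_⟩
  simp only [map_add, LinearMap.add_apply, hs y x] at hc
  push_cast; linarith

theorem L1_int (h8 : 8 ∣ Fintype.card ι) : ∀ x ∈ L1 ι, ∀ y ∈ L1 ι, ZZ (BV ι x y) :=
  int_of_even BV_symm fun _ hx => L1_even h8 hx

variable [DecidableEq ι] [DecidableEq κ]

/-- The orthonormal basis vectors. -/
def eps (i : ι) : VV ι := (0, Pi.single i 1)
/-- Basis of `U²`. -/
def ub (ι : Type) (i : Fin 4) : VV ι := (Pi.single i 1, 0)

theorem BV_eps (x : VV ι) (i : ι) : BV ι x (eps i) = - x.2 i := by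
  simp [BV_apply, eps, UForm, Pi.single_apply]

theorem BV_ub0 (x : VV ι) : BV ι x (ub ι 0) = x.1 1 := by simp [BV_apply, ub, UForm]
theorem BV_ub1 (x : VV ι) : BV ι x (ub ι 1) = x.1 0 := by simp [BV_apply, ub, UForm]
theorem BV_ub2 (x : VV ι) : BV ι x (ub ι 2) = x.1 3 := by simp [BV_apply, ub, UForm]
theorem BV_ub3 (x : VV ι) : BV ι x (ub ι 3) = x.1 2 := by simp [BV_apply, ub, UForm]

theorem ZZ_single {α : Type*} [DecidableEq α] (i j : α) : ZZ ((Pi.single i (1 : ℚ) : α → ℚ) j) := by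
  by_cases h : j = i
  · subst h; simpa using ZZ.one
  · simpa [h] using ZZ.zero

theorem ub_mem (i : Fin 4) : ub ι i ∈ L1 ι :=
  ⟨fun j => ZZ_single i j, (Dp ι).zero_mem⟩

theorem eps_add_mem (i j : ι) : eps i + eps j ∈ L1 ι := by
  refine ⟨fun k => by simpa [eps] using ZZ.zero, Or.inl fun k => ?_, 1, ?_⟩
  · exact (ZZ_single i k).add (ZZ_single j k)
  · simp [eps, Finset.sum_add_distrib]; norm_num

theorem eps_sub_mem (i j : ι) : eps i - eps j ∈ L1 ι := by
  refine ⟨fun k => by simpa [eps] using ZZ.zero, Or.inl fun k => ?_, 0, ?_⟩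
  · exact (ZZ_single i k).sub (ZZ_single j k)
  · simp [eps]

theorem half_mem (h8 : 8 ∣ Fintype.card ι) : ((0, fun _ => 1 / 2) : VV ι) ∈ L1 ι := by
  obtain ⟨m, hm⟩ := h8
  refine ⟨fun k => ZZ.zero, Or.inr fun k => by simpa using ZZ.zero, 2 * m, ?_⟩
  simp only [Finset.sum_const, Finset.card_univ, hm, nsmul_eq_mul]
  push_cast; ring

theorem L1_unimod (h8 : 8 ∣ Fintype.card ι) {x : VV ι} (h : ∀ y ∈ L1 ι, ZZ (BV ι x y)) :
    x ∈ L1 ι := by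
  refine ⟨?_, ?_, ?_⟩
  · have h0 := h _ (ub_mem 0)
    have h1 := h _ (ub_mem 1)
    have h2 := h _ (ub_mem 2)
    have h3 := h _ (ub_mem 3)
    rw [BV_ub0] at h0
    rw [BV_ub1] at h1
    rw [BV_ub2] at h2
    rw [BV_ub3] at h3
    intro i; fin_cases i <;> assumption
  · have hij : ∀ i j, ZZ (x.2 i + x.2 j) := by
      intro i j
      have := (h _ (eps_add_mem i j)).neg
      rw [map_add, BV_eps, BV_eps] at this
      have e : x.2 i + x.2 j = -(-x.2 i + -x.2 j) := by ring
      rwa [e]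
    by_cases hi : ∃ i, ZZ (x.2 i)
    · obtain ⟨i, hi⟩ := hi
      refine Or.inl fun j => ?_
      have := (hij i j).sub hi
      simpa using this
    · push Not at hi
      refine Or.inr fun j => ?_
      obtain ⟨n, hn⟩ := hij j j
      rcases Int.even_or_odd' n with ⟨k, hk | hk⟩
      · exact absurd ⟨k, by rw [hk] at hn; push_cast at hn; linarith⟩ (hi j)
      · exact ⟨k, by rw [hk] at hn; push_cast at hn; linarith⟩
  · obtain ⟨n, hn⟩ := h _ (half_mem h8)
    refine ⟨-n, ?_⟩
    simp only [BV_apply, UForm, ← Finset.sum_mul] at hn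
    simp at hn
    push_cast; linarith

theorem BV_nondeg {x : VV ι} (h : ∀ y, BV ι x y = 0) : x = 0 := by
  ext i
  · have h0 := h (ub ι 0)
    have h1 := h (ub ι 1)
    have h2 := h (ub ι 2)
    have h3 := h (ub ι 3)
    rw [BV_ub0] at h0
    rw [BV_ub1] at h1
    rw [BV_ub2] at h2
    rw [BV_ub3] at h3
    fin_cases i <;> assumption
  · have := h (eps i)
    rw [BV_eps] at this
    simpa using this

/-- Isometry of lattices. -/
def IsIso {V W : Type*} [AddCommGroup V] [Module ℚ V] [AddCommGroup W] [Module ℚ W]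
    (B : V → V → ℚ) (L : Set V) (B' : W → W → ℚ) (L' : Set W) (φ : V ≃ₗ[ℚ] W) : Prop :=
  (∀ x y, B' (φ x) (φ y) = B x y) ∧ ∀ x, φ x ∈ L' ↔ x ∈ L

section
variable {V W X : Type*} [AddCommGroup V] [Module ℚ V] [AddCommGroup W] [Module ℚ W]
  [AddCommGroup X] [Module ℚ X]
  {B : V → V → ℚ} {L : Set V} {B' : W → W → ℚ} {L' : Set W} {B'' : X → X → ℚ} {L'' : Set X}

theorem IsIso.trans {φ : V ≃ₗ[ℚ] W} {ψ : W ≃ₗ[ℚ] X} (h : IsIso B L B' L' φ)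
    (k : IsIso B' L' B'' L'' ψ) : IsIso B L B'' L'' (φ.trans ψ) :=
  ⟨fun x y => by simp [h.1, k.1], fun x => by simp [h.2, k.2]⟩

theorem IsIso.symm {φ : V ≃ₗ[ℚ] W} (h : IsIso B L B' L' φ) : IsIso B' L' B L φ.symm :=
  ⟨fun x y => by rw [← h.1]; simp, fun x => by rw [← h.2]; simp⟩
end

/-- The form as a function. -/
abbrev BF (ι : Type) [Fintype ι] (x y : VV ι) : ℚ := BV ι x y

/-- Vectors of `U² ⊕ D_n⁺` vanishing in the coordinates satisfying `P`. -/
def KS (ι : Type) [Fintype ι] (P : ι → Prop) : AddSubgroup (VV ι) where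
  carrier := {x | x ∈ L1 ι ∧ ∀ i, P i → x.2 i = 0}
  zero_mem' := ⟨(L1 ι).zero_mem, fun _ _ => rfl⟩
  add_mem' := fun h k => ⟨(L1 ι).add_mem h.1 k.1, fun i hi => by simp [h.2 i hi, k.2 i hi]⟩
  neg_mem' := fun h => ⟨(L1 ι).neg_mem h.1, fun i hi => by simp [h.2 i hi]⟩

theorem mem_KS {P : ι → Prop} {x : VV ι} :
    x ∈ KS ι P ↔ x ∈ L1 ι ∧ ∀ i, P i → x.2 i = 0 := Iff.rfl

theorem ub_mem_KS (P : ι → Prop) (i : Fin 4) : ub ι i ∈ KS ι P := ⟨ub_mem i, fun _ _ => rfl⟩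

/-- Eichler's criterion for the model lattices. -/
theorem eichV (h8 : 8 ∣ Fintype.card ι) (P : ι → Prop) {v w : VV ι}
    (hv : ∀ a ∈ KS ι P, ZZ (BV ι v a)) (h1 : ∃ a ∈ KS ι P, BV ι v a = 1)
    (hw : ∀ a ∈ KS ι P, ZZ (BV ι w a)) (k1 : ∃ a ∈ KS ι P, BV ι w a = 1)
    (hd : v - w ∈ KS ι P) (hn : BV ι v v = BV ι w w) :
    ∃ φ : VV ι ≃ₗ[ℚ] VV ι, IsIso (BF ι) (L1 ι) (BF ι) (L1 ι) φ ∧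
      (∀ i, P i → φ (eps i) = eps i) ∧ φ v = w := by
  have hIntg : ∀ x ∈ KS ι P, ∀ y ∈ KS ι P, ZZ (BV ι x y) := fun x hx y hy =>
    L1_int h8 x hx.1 y hy.1
  obtain ⟨φ, hφ, hφv⟩ := eichler (B := BV ι) (K := KS ι P) BV_symm hIntg
    (fun x hx => L1_even h8 hx.1)
    (ub_mem_KS P 0) (ub_mem_KS P 1) (ub_mem_KS P 2) (ub_mem_KS P 3)
    (by rw [BV_ub0]; simp [ub]) (by rw [BV_ub1]; simp [ub]) (by rw [BV_ub2]; simp [ub])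
    (by rw [BV_ub3]; simp [ub]) (by rw [BV_ub1]; simp [ub]) (by rw [BV_ub3]; simp [ub])
    (by rw [BV_ub2]; simp [ub]) (by rw [BV_ub3]; simp [ub]) (by rw [BV_ub2]; simp [ub])
    (by rw [BV_ub3]; simp [ub]) hv h1 hw k1 hd hn
  have hfw : ∀ ψ : VV ι ≃ₗ[ℚ] VV ι, Good (BV ι) (KS ι P) ψ → ∀ x ∈ L1 ι, ψ x ∈ L1 ι := by
    intro ψ hψ x hx
    have := (hψ.2.1 x fun a ha => L1_int h8 x hx a ha.1).1
    have := (L1 ι).add_mem this hx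
    simpa using this
  refine ⟨φ, ⟨hφ.1, fun x => ⟨fun h => ?_, fun h => hfw φ hφ x h⟩⟩, fun i hi => ?_, hφv⟩
  · have := hfw φ.symm (hφ.symm hIntg) _ h
    simpa using this
  · refine hφ.2.2 _ fun a ha => ?_
    rw [BV_symm, BV_eps, ha.2 i hi, neg_zero]

/-- If no prime divides all values then the value one is attained. -/
theorem exists_one {V : Type*} [AddCommGroup V] [Module ℚ V] {B : LinearMap.BilinForm ℚ V}
    {K : AddSubgroup V} {v : V} (hv : ∀ a ∈ K, ZZ (B v a))
    (hp : ∀ p : ℕ, p.Prime → ¬ ∀ a ∈ K, ∃ n : ℤ, B v a = (p : ℚ) * n) :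
    ∃ a ∈ K, B v a = 1 := by
  let A : AddSubgroup ℤ :=
    { carrier := {n | ∃ a ∈ K, B v a = (n : ℚ)}
      zero_mem' := ⟨0, K.zero_mem, by simp⟩
      add_mem' := by
        rintro x y ⟨a, ha, h⟩ ⟨b, hb, k⟩
        exact ⟨a + b, K.add_mem ha hb, by simp [h, k]⟩
      neg_mem' := by
        rintro x ⟨a, ha, h⟩
        exact ⟨-a, K.neg_mem ha, by simp [h]⟩ }
  obtain ⟨d, hd⟩ := Int.subgroup_cyclic A
  have hdv : ∀ n, n ∈ A ↔ d ∣ n := by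
    intro n; rw [hd, AddSubgroup.mem_closure_singleton]
    constructor
    · rintro ⟨k, rfl⟩; exact ⟨k, by simp [mul_comm]⟩
    · rintro ⟨k, rfl⟩; exact ⟨k, by simp [mul_comm]⟩
  by_cases h1 : d.natAbs = 1
  · have : (1 : ℤ) ∈ A := (hdv 1).2 (Int.natAbs_dvd_natAbs.mp (by simp [h1]))
    obtain ⟨a, ha, h⟩ := this
    exact ⟨a, ha, by simpa using h⟩
  · exfalso
    obtain ⟨p, hpp, hpd⟩ := Nat.exists_prime_and_dvd h1
    refine hp p hpp fun a ha => ?_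
    obtain ⟨n, hn⟩ := hv a ha
    have : d ∣ n := (hdv n).1 ⟨a, ha, hn⟩
    obtain ⟨k, hk⟩ := (Int.natCast_dvd.mpr hpd).trans this
    exact ⟨k, by rw [hn, hk]; push_cast; rfl⟩

end Model

section Chain

theorem pcoords {ι : Type} [Fintype ι] [DecidableEq ι] (P : ι → Prop) {v : VV ι} {p : ℕ}
    (hp : ∀ a ∈ KS ι P, ∃ n : ℤ, BV ι v a = (p : ℚ) * n) :
    (∀ i : Fin 4, ∃ n : ℤ, v.1 i = (p : ℚ) * n) ∧
    ∀ i j, ¬ P i → ¬ P j → (∃ n : ℤ, v.2 i + v.2 j = (p : ℚ) * n) := by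
  constructor
  · have h0 := hp _ (ub_mem_KS P 0)
    have h1 := hp _ (ub_mem_KS P 1)
    have h2 := hp _ (ub_mem_KS P 2)
    have h3 := hp _ (ub_mem_KS P 3)
    rw [BV_ub0] at h0
    rw [BV_ub1] at h1
    rw [BV_ub2] at h2
    rw [BV_ub3] at h3
    intro i; fin_cases i <;> assumption
  · intro i j hi hj
    obtain ⟨n, hn⟩ := hp (eps i + eps j) ⟨eps_add_mem i j, fun k hk => by
      have h1 : k ≠ i := fun h => hi (h ▸ hk)
      have h2 : k ≠ j := fun h => hj (h ▸ hk)
      simp [eps, h1, h2]⟩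
    rw [map_add, BV_eps, BV_eps] at hn
    exact ⟨-n, by push_cast; linarith⟩

theorem p_dvd_norm {ι : Type} [Fintype ι] [DecidableEq ι] (P : ι → Prop) {v : VV ι} {p : ℕ}
    (hz : ∀ i, P i → v.2 i = 0)
    (hp : ∀ a ∈ KS ι P, ∃ n : ℤ, BV ι v a = (p : ℚ) * n) :
    ∃ n : ℤ, 4 * BV ι v v = (p : ℚ) * n := by
  obtain ⟨h1, h2⟩ := pcoords P hp
  choose a ha using h1
  have h3 : ∀ i, ∃ n : ℤ, 2 * v.2 i = (p : ℚ) * n := by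
    intro i
    by_cases hi : P i
    · exact ⟨0, by simp [hz i hi]⟩
    · obtain ⟨n, hn⟩ := h2 i i hi hi
      exact ⟨n, by linarith⟩
  choose b hb using h3
  refine ⟨8 * p * (a 0 * a 1 + a 2 * a 3) - p * ∑ i, b i * b i, ?_⟩
  have e : ∑ i, v.2 i * v.2 i = (p : ℚ) * p * (∑ i, (b i : ℚ) * b i) / 4 := by
    rw [Finset.mul_sum, Finset.sum_div]
    refine Finset.sum_congr rfl fun i _ => ?_
    have : v.2 i = p * b i / 2 := by linarith [hb i]
    rw [this]; ring
  rw [BV_apply, e, UForm, ha 0, ha 1, ha 2, ha 3]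
  push_cast; ring

/-- Extension of a coordinate vector by zero. -/
def xn {q : ℕ} (x : Fin q → ℚ) (i : ℕ) : ℚ := if h : i < q then x ⟨i, h⟩ else 0

/-- Basis vectors indexed by natural numbers. -/
def epsN (q : ℕ) (i : ℕ) : VV (Fin q) := if h : i < q then eps ⟨i, h⟩ else 0

theorem epsN_eq {q i : ℕ} (h : i < q) : epsN q i = eps ⟨i, h⟩ := by simp [epsN, h]

theorem sum_eps {ι : Type} [Fintype ι] [DecidableEq ι] (x : ι → ℚ) :
    ∑ i, x i • eps i = ((0, x) : VV ι) := by
  ext j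
  · simp [eps, Prod.fst_sum]
  · simp [eps, Prod.snd_sum, Finset.sum_apply, Pi.single_apply]

theorem sum_epsN {q k : ℕ} (hk : k ≤ q) (x : Fin q → ℚ) (hx : ∀ i : Fin q, k ≤ i.val → x i = 0) :
    ∑ i ∈ Finset.range k, xn x i • epsN q i = ((0, x) : VV (Fin q)) := by
  rw [← sum_eps, Finset.sum_subset (Finset.range_subset_range.mpr hk), Finset.sum_range]
  · refine Finset.sum_congr rfl fun i _ => ?_
    simp [xn, epsN]
  · intro i hi hik
    simp only [Finset.mem_range] at hi hik
    simp [xn, hi, hx ⟨i, hi⟩ (by simpa using hik)]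

/-- Orthonormality of the first `k` vectors. -/
def Orth {V : Type*} (B : V → V → ℚ) (g : ℕ → V) (k : ℕ) : Prop :=
  ∀ i < k, ∀ j < k, B (g i) (g j) = if i = j then -1 else 0

/-- The first `k` vectors span a saturated copy of `D_k`. -/
def Sat {V : Type*} [AddCommGroup V] [Module ℚ V] (L : Set V) (g : ℕ → V) (k : ℕ) : Prop :=
  ∀ c : ℕ → ℚ, (∑ i ∈ Finset.range k, c i • g i) ∈ L ↔
    ((∀ i < k, ZZ (c i)) ∧ ∃ a : ℤ, ∑ i ∈ Finset.range k, c i = 2 * (a : ℚ))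

theorem Orth.map {V W : Type*} [AddCommGroup V] [Module ℚ V] [AddCommGroup W] [Module ℚ W]
    {B : V → V → ℚ} {L : Set V} {B' : W → W → ℚ} {L' : Set W} {φ : V ≃ₗ[ℚ] W}
    (h : IsIso B L B' L' φ) {g : ℕ → V} {k : ℕ} (hg : Orth B g k) :
    Orth B' (fun i => φ (g i)) k := fun i hi j hj => by rw [h.1, hg i hi j hj]

theorem Sat.map {V W : Type*} [AddCommGroup V] [Module ℚ V] [AddCommGroup W] [Module ℚ W]
    {B : V → V → ℚ} {L : Set V} {B' : W → W → ℚ} {L' : Set W} {φ : V ≃ₗ[ℚ] W}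
    (h : IsIso B L B' L' φ) {g : ℕ → V} {k : ℕ} (hg : Sat L g k) :
    Sat L' (fun i => φ (g i)) k := fun c => by
  rw [← hg c, ← h.2]
  simp [map_sum]

theorem Sat.down {V : Type*} [AddCommGroup V] [Module ℚ V] {L : Set V} {g : ℕ → V} {k : ℕ}
    (h : Sat L g (k + 1)) : Sat L g k := by
  intro c
  have := h (fun i => if i < k then c i else 0)
  rw [Finset.sum_range_succ, Finset.sum_range_succ] at this
  have e1 : ∑ i ∈ Finset.range k, (if i < k then c i else 0) • g i =
      ∑ i ∈ Finset.range k, c i • g i :=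
    Finset.sum_congr rfl fun i hi => by simp [Finset.mem_range.mp hi]
  have e2 : ∑ i ∈ Finset.range k, (if i < k then c i else 0) =
      ∑ i ∈ Finset.range k, c i :=
    Finset.sum_congr rfl fun i hi => by simp [Finset.mem_range.mp hi]
  rw [e1, e2] at this
  simp only [lt_irrefl, if_false, zero_smul, add_zero] at this
  rw [this]
  refine and_congr_left fun _ => ⟨fun h i hi => ?_, fun h i hi => ?_⟩
  · simpa [hi] using h i (by omega)
  · by_cases hik : i < k
    · simpa [hik] using h i hik
    · simpa [hik] using ZZ.zero

theorem step_unit {q : ℕ} (h8 : 8 ∣ q) {k : ℕ} (hk1 : 1 ≤ k) (hk : k ≤ q) {w : VV (Fin q)}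
    (hz : ∀ i : Fin q, i.val < k → w.2 i = 0) (hn : BV (Fin q) w w = -1)
    (h0 : epsN q 0 + w ∈ L1 (Fin q))
    (hsat : ∀ (x : Fin q → ℚ) (t : ℚ), (∀ i : Fin q, k ≤ i.val → x i = 0) →
      ((0, x) : VV (Fin q)) + t • w ∈ L1 (Fin q) → ZZ t)
    (hdual : ∀ a ∈ KS (Fin q) (fun i => i.val < k), ZZ (BV (Fin q) w a)) :
    ∃ a ∈ KS (Fin q) (fun i => i.val < k), BV (Fin q) w a = 1 := by
  refine exists_one hdual fun p hpp hp => ?_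
  have hq : 0 < q := by omega
  have hp2 : p = 2 := by
    obtain ⟨n, hn'⟩ := p_dvd_norm (fun i : Fin q => i.val < k) hz hp
    rw [hn] at hn'
    have : (p : ℤ) ∣ 4 := ⟨-n, by
      have : (4 : ℚ) = p * (-n) := by linarith
      exact_mod_cast this⟩
    have h4 : p ∣ 2 ^ 2 := by exact_mod_cast this
    exact (Nat.prime_dvd_prime_iff_eq hpp Nat.prime_two).mp (hpp.dvd_of_dvd_pow h4)
  subst hp2
  obtain ⟨h1, h2⟩ := pcoords _ hp
  rw [epsN_eq hq] at h0
  -- integrality of the coordinates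
  have hwint : ∀ i, ZZ (w.2 i) := by
    intro i
    by_cases hi : i.val < k
    · rw [hz i hi]; exact ZZ.zero
    · have hi0 : i ≠ ⟨0, hq⟩ := by rintro rfl; exact hi hk1
      rcases h0.2.1 with h | h
      · simpa [eps, hi0] using h i
      · have h00 := h ⟨0, hq⟩
        simp only [eps, Prod.snd_add, Pi.add_apply, Pi.single_eq_same,
          hz ⟨0, hq⟩ (show 0 < k from hk1)] at h00
        obtain ⟨a, ha⟩ := h00
        exfalso
        have : (1 : ℚ) = 2 * a := by linarith
        have : (1 : ℤ) = 2 * a := by exact_mod_cast this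
        omega
  choose b hb using hwint
  have hpar : ∀ i j : Fin q, ¬ i.val < k → ¬ j.val < k → ∃ n : ℤ, b i + b j = 2 * n := by
    intro i j hi hj
    obtain ⟨n, hn⟩ := h2 i j hi hj
    refine ⟨n, ?_⟩
    rw [hb i, hb j] at hn
    exact_mod_cast hn
  have hodd : ∀ i : Fin q, ¬ i.val < k → ∃ n : ℤ, b i = 2 * n + 1 := by
    intro i hi
    rcases Int.even_or_odd' (b i) with ⟨m, hm | hm⟩
    · exfalso
      have hev : ∀ j, ∃ n : ℤ, w.2 j = 2 * (n : ℚ) := by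
        intro j
        by_cases hj : j.val < k
        · exact ⟨0, by simp [hz j hj]⟩
        · obtain ⟨n, hn⟩ := hpar i j hi hj
          refine ⟨n - m, ?_⟩
          rw [hb j]
          have : b j = 2 * (n - m) := by omega
          exact_mod_cast this
      choose n hn using hev
      obtain ⟨s, hs⟩ := h0.2.2
      simp only [eps, Prod.snd_add, Pi.add_apply, Finset.sum_add_distrib, hn,
        ← Finset.mul_sum, Finset.sum_pi_single', Finset.mem_univ, if_true] at hs
      have : (1 : ℤ) + 2 * ∑ i, n i = 2 * s := by exact_mod_cast hs
      omega
    · exact ⟨m, hm⟩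
  -- the half vector
  let x : Fin q → ℚ := fun i => if i.val < k then 1 / 2 else 0
  have hxz : ∀ i : Fin q, k ≤ i.val → x i = 0 := fun i hi => by simp [x, not_lt.mpr hi]
  have hhalf : ∀ i, ∃ n : ℤ, x i + (1 / 2) * w.2 i = 1 / 2 + (n : ℚ) := by
    intro i
    by_cases hi : i.val < k
    · exact ⟨0, by simp [x, hi, hz i hi]⟩
    · obtain ⟨n, hn⟩ := hodd i hi
      refine ⟨n, ?_⟩
      rw [hb i, hn]; simp [x, hi]; ring
  choose c hc using hhalf
  obtain ⟨m, hm⟩ := h8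
  have hsumz : ∑ i, (x i + (1 / 2) * w.2 i) = ((4 * m + ∑ i, c i : ℤ) : ℚ) := by
    rw [Finset.sum_congr rfl fun i _ => hc i, Finset.sum_add_distrib]
    simp only [Finset.sum_const, Finset.card_univ, Fintype.card_fin, nsmul_eq_mul]
    have hmq : (q : ℚ) = 8 * m := by exact_mod_cast hm
    rw [hmq]; push_cast; ring
  have hone : ¬ ZZ (1 / 2 : ℚ) := by
    rintro ⟨a, ha⟩
    have : (1 : ℚ) = 2 * a := by linarith
    have : (1 : ℤ) = 2 * a := by exact_mod_cast this
    omega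
  have hU : ∀ i, ZZ ((1 / 2) * w.1 i) := by
    intro i
    obtain ⟨n, hn⟩ := h1 i
    exact ⟨n, by rw [hn]; push_cast; ring⟩
  rcases Int.even_or_odd' (4 * m + ∑ i, c i) with ⟨s, hs | hs⟩
  · refine hone (hsat x (1 / 2) hxz ⟨fun i => ?_, Or.inr fun i => ?_, s, ?_⟩)
    · simpa using hU i
    · refine ⟨c i, ?_⟩
      have := hc i
      simp only [Prod.snd_add, Prod.smul_snd, Pi.add_apply, Pi.smul_apply, smul_eq_mul]
      linarith
    · simp only [Prod.snd_add, Prod.smul_snd, Pi.add_apply, Pi.smul_apply, smul_eq_mul]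
      rw [hsumz, hs]; push_cast; ring
  · refine hone (hsat (x - Pi.single ⟨0, hq⟩ 1) (1 / 2) ?_ ⟨fun i => ?_, Or.inr fun i => ?_, s, ?_⟩)
    · intro i hi
      have : i ≠ ⟨0, hq⟩ := by rintro rfl; simp at hi; omega
      simp [hxz i hi, this]
    · simpa using hU i
    · obtain ⟨d, hd⟩ := ZZ_single (⟨0, hq⟩ : Fin q) i
      refine ⟨c i - d, ?_⟩
      have := hc i
      simp only [Prod.snd_add, Prod.smul_snd, Pi.add_apply, Pi.sub_apply, Pi.smul_apply,
        smul_eq_mul, hd]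
      push_cast
      linarith
    · simp only [Prod.snd_add, Prod.smul_snd, Pi.add_apply, Pi.sub_apply, Pi.smul_apply,
        smul_eq_mul]
      have e : ∀ i : Fin q, x i - (Pi.single (⟨0, hq⟩ : Fin q) (1 : ℚ) : Fin q → ℚ) i
          + 1 / 2 * w.2 i =
          (x i + 1 / 2 * w.2 i) - (Pi.single (⟨0, hq⟩ : Fin q) (1 : ℚ) : Fin q → ℚ) i :=
        fun i => by ring
      rw [Finset.sum_congr rfl fun i _ => e i, Finset.sum_sub_distrib, hsumz, hs]
      simp

theorem chain {q : ℕ} (h8 : 8 ∣ q) (k : ℕ) (hk1 : 1 ≤ k) : k + 1 ≤ q →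
    ∀ g : ℕ → VV (Fin q), Orth (BF (Fin q)) g k → Sat (L1 (Fin q) : Set (VV (Fin q))) g k →
    ∃ φ : VV (Fin q) ≃ₗ[ℚ] VV (Fin q),
      IsIso (BF (Fin q)) (L1 (Fin q)) (BF (Fin q)) (L1 (Fin q)) φ ∧
      ∀ i < k, φ (g i) = epsN q i := by
  have h8' : 8 ∣ Fintype.card (Fin q) := by simpa using h8
  induction k, hk1 using Nat.le_induction with
  | base =>
    intro hq g hO hS
    have hq0 : 0 < q := by omega
    have hs1 : ∀ c : ℚ, c • g 0 ∈ L1 (Fin q) ↔ ∃ a : ℤ, c = 2 * (a : ℚ) := by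
      intro c
      have := hS (fun _ => c)
      simp only [Finset.range_one, Finset.sum_singleton, SetLike.mem_coe] at this
      rw [this]
      refine ⟨fun h => h.2, fun h => ⟨fun i _ => ?_, h⟩⟩
      obtain ⟨a, ha⟩ := h
      exact ⟨2 * a, by rw [ha]; push_cast; rfl⟩
    have hK : ∀ a, a ∈ KS (Fin q) (fun _ => False) ↔ a ∈ L1 (Fin q) := fun a => by
      simp [mem_KS]
    have hgL : (2 : ℚ) • g 0 ∈ L1 (Fin q) := (hs1 2).2 ⟨1, by simp⟩
    have heL : (2 : ℚ) • epsN q 0 ∈ L1 (Fin q) := by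
      rw [two_smul, epsN_eq hq0]; exact eps_add_mem _ _
    obtain ⟨φ, hφ, -, hφv⟩ := eichV h8' (fun _ => False) (v := (2 : ℚ) • g 0)
      (w := (2 : ℚ) • epsN q 0)
      (fun a ha => L1_int h8' _ hgL a ha.1)
      (by
        refine exists_one (fun a ha => L1_int h8' _ hgL a ha.1) fun p hpp hp => ?_
        have hp0 : (p : ℚ) ≠ 0 := by exact_mod_cast hpp.ne_zero
        have : ((1 : ℚ) / p * 2) • g 0 ∈ L1 (Fin q) := by
          rw [mul_smul]
          refine L1_unimod h8' fun y hy => ?_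
          obtain ⟨n, hn⟩ := hp y ((hK y).2 hy)
          refine ⟨n, ?_⟩
          rw [map_smul, LinearMap.smul_apply, hn, smul_eq_mul]
          field_simp
        obtain ⟨a, ha⟩ := (hs1 _).1 this
        have h1 : (1 : ℚ) = p * a := by field_simp at ha; linarith
        have h2 : (1 : ℤ) = p * a := by exact_mod_cast h1
        have h3 : (p : ℤ) ∣ 1 := ⟨a, h2⟩
        have h4 : p ∣ 1 := by exact_mod_cast h3
        exact hpp.one_lt.ne' (Nat.dvd_one.mp h4))
      (fun a ha => L1_int h8' _ heL a ha.1)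
      ⟨-(0, fun _ => 1 / 2), (KS _ _).neg_mem ((hK _).2 (half_mem h8')), by
        rw [BV_symm, map_smul, epsN_eq hq0, BV_eps]; simp⟩
      ((hK _).2 ((L1 _).sub_mem hgL heL))
      (by
        have := hO 0 (by omega) 0 (by omega)
        simp only [BF] at this
        simp only [map_smul, LinearMap.smul_apply, this, epsN_eq hq0, BV_eps]
        simp [eps])
    refine ⟨φ, hφ, fun i hi => ?_⟩
    obtain rfl : i = 0 := by omega
    rw [map_smul] at hφv
    exact smul_right_injective _ (two_ne_zero (α := ℚ)) hφv
  | succ k hk1 ih =>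
    intro hq g hO hS
    obtain ⟨φ, hφ, hφg⟩ := ih (by omega) g (fun i hi j hj => hO i (by omega) j (by omega)) hS.down
    have hO' := hO.map hφ
    have hS' := hS.map hφ
    set w := φ (g k) with hw
    have hq0 : 0 < q := by omega
    have hz : ∀ i : Fin q, i.val < k → w.2 i = 0 := by
      intro i hi
      have := hO' k (by omega) i.val (by omega)
      simp only [hφg i.val hi, BF] at this
      rw [epsN_eq i.isLt, BV_eps, if_neg (by omega)] at this
      simpa using this
    have hn : BV (Fin q) w w = -1 := by simpa using hO' k (by omega) k (by omega)
    have hcomb : ∀ (x : Fin q → ℚ) (t : ℚ), (∀ i : Fin q, k ≤ i.val → x i = 0) →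
        ∑ i ∈ Finset.range (k + 1), (if i < k then xn x i else t) • φ (g i) =
          ((0, x) : VV (Fin q)) + t • w := by
      intro x t hx
      rw [Finset.sum_range_succ, ← sum_epsN (by omega : k ≤ q) x hx]
      congr 1
      · refine Finset.sum_congr rfl fun i hi => ?_
        rw [if_pos (Finset.mem_range.mp hi), hφg i (Finset.mem_range.mp hi)]
      · rw [if_neg (lt_irrefl k)]
    have hsat : ∀ (x : Fin q → ℚ) (t : ℚ), (∀ i : Fin q, k ≤ i.val → x i = 0) →
      ((0, x) : VV (Fin q)) + t • w ∈ L1 (Fin q) → ZZ t := by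
      intro x t hx hm
      rw [← hcomb x t hx] at hm
      have := ((hS' _).1 hm).1 k (by omega)
      simpa using this
    have h0 : epsN q 0 + w ∈ L1 (Fin q) := by
      have e := hcomb (Pi.single ⟨0, hq0⟩ 1) 1 (fun i hi => by
        have : i ≠ ⟨0, hq0⟩ := by rintro rfl; simp at hi; omega
        simp [this])
      rw [one_smul] at e
      have e2 : epsN q 0 = ((0, Pi.single ⟨0, hq0⟩ 1) : VV (Fin q)) := epsN_eq hq0
      rw [e2, ← e]
      refine (hS' _).2 ⟨fun i hi => ?_, 1, ?_⟩
      · by_cases hik : i < k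
        · simp only [hik, if_true, xn, show i < q by omega, dif_pos]
          exact ZZ_single _ _
        · simpa [hik] using ZZ.one
      · rw [Finset.sum_range_succ, if_neg (lt_irrefl k), Finset.sum_eq_single 0]
        · simp [xn, hq0, show 0 < k by omega]; norm_num
        · intro i hi hi0
          have : i < k := Finset.mem_range.mp hi
          simp [this, xn, show i < q by omega, hi0]
        · intro h; simp at h; omega
    have hperp : ∀ a ∈ KS (Fin q) (fun i => i.val < k), BV (Fin q) (epsN q 0) a = 0 := by
      intro a ha
      rw [BV_symm, epsN_eq hq0, BV_eps, ha.2 ⟨0, hq0⟩ (show 0 < k from hk1), neg_zero]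
    have hdual : ∀ a ∈ KS (Fin q) (fun i => i.val < k), ZZ (BV (Fin q) w a) := by
      intro a ha
      have := L1_int h8' _ h0 a ha.1
      rwa [map_add, LinearMap.add_apply, hperp a ha, zero_add] at this
    have hkq : k < q := by omega
    have hkq' : k + 1 < q := by omega
    obtain ⟨ψ, hψ, hψe, hψw⟩ := eichV h8' (fun i : Fin q => i.val < k) (v := w) (w := epsN q k)
      hdual (step_unit h8 hk1 (by omega) hz hn h0 hsat hdual)
      (fun a ha => by
        have := L1_int h8' _ (eps_add_mem (⟨0, hq0⟩ : Fin q) ⟨k, hkq⟩) a ha.1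
        rwa [map_add, LinearMap.add_apply, ← epsN_eq hq0, ← epsN_eq hkq, hperp a ha,
          zero_add] at this)
      ⟨-(eps ⟨k, hkq⟩ + eps ⟨k + 1, hkq'⟩), ⟨(L1 _).neg_mem (eps_add_mem _ _), fun i hi => by
          have h1 : i ≠ ⟨k, hkq⟩ := by rintro rfl; simp at hi
          have h2 : i ≠ ⟨k + 1, hkq'⟩ := by rintro rfl; simp at hi
          simp [eps, h1, h2]⟩, by
        rw [BV_symm, epsN_eq hkq, BV_eps]; simp [eps]⟩
      ⟨by
        have := (L1 _).sub_mem h0 (eps_add_mem (⟨0, hq0⟩ : Fin q) ⟨k, hkq⟩)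
        rw [← epsN_eq hq0, ← epsN_eq hkq] at this
        simpa using this, fun i hi => by
          have h1 : i ≠ ⟨k, hkq⟩ := by rintro rfl; simp at hi
          simp [epsN_eq hkq, eps, h1, hz i hi]⟩
      (by rw [hn, epsN_eq hkq, BV_eps]; simp [eps])
    refine ⟨φ.trans ψ, hφ.trans hψ, fun i hi => ?_⟩
    rw [LinearEquiv.trans_apply]
    rcases Nat.lt_succ_iff_lt_or_eq.mp hi with hik | rfl
    · have hiq : i < q := by omega
      rw [hφg i hik, epsN_eq hiq]
      exact hψe ⟨i, hiq⟩ hik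
    · exact hψw

end Chain

section E8

/-- The first eight vectors span a saturated copy of `E₈`. -/
def Sat8 {V : Type*} [AddCommGroup V] [Module ℚ V] (L : Set V) (g : ℕ → V) : Prop :=
  ∀ c : ℕ → ℚ, (∑ i ∈ Finset.range 8, c i • g i) ∈ L ↔ (fun i : Fin 8 => c i.val) ∈ Dp (Fin 8)

theorem Sat8.map {V W : Type*} [AddCommGroup V] [Module ℚ V] [AddCommGroup W] [Module ℚ W]
    {B : V → V → ℚ} {L : Set V} {B' : W → W → ℚ} {L' : Set W} {φ : V ≃ₗ[ℚ] W}
    (h : IsIso B L B' L' φ) {g : ℕ → V} (hg : Sat8 L g) :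
    Sat8 L' (fun i => φ (g i)) := fun c => by
  rw [← hg c, ← h.2]
  simp [map_sum]

theorem not_ZZ_half : ¬ ZZ (1 / 2 : ℚ) := by
  rintro ⟨a, ha⟩
  have : (1 : ℚ) = 2 * a := by linarith
  have : (1 : ℤ) = 2 * a := by exact_mod_cast this
  omega

theorem not_ZZ_half' : ¬ ZZ (0 - 1 / 2 : ℚ) := fun h => not_ZZ_half (by simpa using h.neg)

theorem Sat8.sat {V : Type*} [AddCommGroup V] [Module ℚ V] {L : Set V} {g : ℕ → V}
    (h : Sat8 L g) : Sat L g 7 := by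
  intro c
  have := h (fun i => if i < 7 then c i else 0)
  rw [Finset.sum_range_succ] at this
  have e1 : ∑ i ∈ Finset.range 7, (if i < 7 then c i else 0) • g i =
      ∑ i ∈ Finset.range 7, c i • g i :=
    Finset.sum_congr rfl fun i hi => by rw [if_pos (Finset.mem_range.mp hi)]
  have e2 : ∑ i ∈ Finset.range 7, (if i < 7 then c i else 0) =
      ∑ i ∈ Finset.range 7, c i :=
    Finset.sum_congr rfl fun i hi => by rw [if_pos (Finset.mem_range.mp hi)]
  rw [e1, if_neg (lt_irrefl 7), zero_smul, add_zero] at this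
  rw [this, mem_Dp, ← Finset.sum_range (fun i => if i < 7 then c i else 0),
    Finset.sum_range_succ, e2, if_neg (lt_irrefl 7), add_zero]
  refine and_congr_left fun _ => ⟨fun h i hi => ?_, fun h => Or.inl fun i => ?_⟩
  · rcases h with h | h
    · simpa [hi] using h ⟨i, by omega⟩
    · have := h 7
      exact absurd this not_ZZ_half'
  · by_cases hik : i.val < 7
    · simpa [hik] using h i hik
    · simpa [hik] using ZZ.zero

/-- Half sum of the first seven basis vectors. -/
def half7 (q : ℕ) : VV (Fin q) := (0, fun i => if i.val < 7 then 1 / 2 else 0)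

theorem e8norm {q : ℕ} (h8 : 8 ∣ q) (hq : 8 < q) {g : ℕ → VV (Fin q)}
    (hO : Orth (BF (Fin q)) g 8) (hS : Sat8 (L1 (Fin q) : Set (VV (Fin q))) g) :
    ∃ (φ : VV (Fin q) ≃ₗ[ℚ] VV (Fin q)),
      IsIso (BF (Fin q)) (L1 (Fin q)) (BF (Fin q)) (L1 (Fin q)) φ ∧
      (∀ i < 7, φ (g i) = epsN q i) ∧
      half7 q + (1 / 2 : ℚ) • φ (g 7) ∈ L1 (Fin q) ∧
      (∀ i : Fin q, i.val < 7 → (φ (g 7)).2 i = 0) ∧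
      BV (Fin q) ((1 / 2 : ℚ) • φ (g 7)) ((1 / 2 : ℚ) • φ (g 7)) = -1 / 4 ∧
      (∀ a ∈ KS (Fin q) (fun i => i.val < 7), ZZ (BV (Fin q) ((1 / 2 : ℚ) • φ (g 7)) a)) ∧
      (∃ a ∈ KS (Fin q) (fun i => i.val < 7), BV (Fin q) ((1 / 2 : ℚ) • φ (g 7)) a = 1) := by
  have h8' : 8 ∣ Fintype.card (Fin q) := by simpa using h8
  obtain ⟨φ, hφ, hφg⟩ := chain h8 7 (by omega) (by omega) g
    (fun i hi j hj => hO i (by omega) j (by omega)) hS.sat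
  have hO' := hO.map hφ
  have hS' := hS.map hφ
  set w := φ (g 7) with hw
  have hz : ∀ i : Fin q, i.val < 7 → w.2 i = 0 := by
    intro i hi
    have := hO' 7 (by omega) i.val (by omega)
    simp only [hφg i.val hi, BF] at this
    rw [epsN_eq i.isLt, BV_eps, if_neg (by omega)] at this
    simpa using this
  have hn : BV (Fin q) w w = -1 := by simpa using hO' 7 (by omega) 7 (by omega)
  have hn' : BV (Fin q) ((1 / 2 : ℚ) • w) ((1 / 2 : ℚ) • w) = -1 / 4 := by
    simp only [map_smul, LinearMap.smul_apply, hn, smul_eq_mul]; norm_num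
  have hL : half7 q + (1 / 2 : ℚ) • w ∈ L1 (Fin q) := by
    have e := sum_epsN (q := q) (k := 7) (by omega) (fun i => if i.val < 7 then 1 / 2 else 0)
      (fun i hi => by simp [not_lt.mpr hi])
    have := (hS' (fun _ => 1 / 2)).2 ⟨Or.inr fun i => by simpa using ZZ.zero, 2, by
      simp; norm_num⟩
    rw [Finset.sum_range_succ] at this
    rw [half7, ← e]
    have e3 : ∑ i ∈ Finset.range 7, (1 / 2 : ℚ) • φ (g i) = ∑ i ∈ Finset.range 7,
        xn (fun i : Fin q => if i.val < 7 then (1 / 2 : ℚ) else 0) i • epsN q i := by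
      refine Finset.sum_congr rfl fun i hi => ?_
      have hi7 := Finset.mem_range.mp hi
      rw [hφg i hi7]
      simp [xn, show i < q by omega, hi7]
    rw [e3] at this
    exact this
  have hdual : ∀ a ∈ KS (Fin q) (fun i => i.val < 7), ZZ (BV (Fin q) ((1 / 2 : ℚ) • w) a) := by
    intro a ha
    have h1 := L1_int h8' _ hL a ha.1
    have h2 : BV (Fin q) (half7 q) a = 0 := by
      simp only [BV_apply, half7, UForm]
      rw [Finset.sum_eq_zero]
      · simp
      · intro i _
        by_cases hi : i.val < 7
        · rw [ha.2 i hi, mul_zero]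
        · simp [hi]
    rwa [map_add, LinearMap.add_apply, h2, zero_add] at h1
  refine ⟨φ, hφ, hφg, hL, hz, hn', hdual, exists_one hdual fun p hpp hp => ?_⟩
  obtain ⟨n, h⟩ := p_dvd_norm (fun i : Fin q => i.val < 7) (fun i hi => by
    show (1 / 2 : ℚ) * w.2 i = 0
    rw [hz i hi, mul_zero]) hp
  rw [hn'] at h
  have h3 : (p : ℤ) ∣ 1 := ⟨-n, by
    have : (1 : ℚ) = p * (-n) := by linarith
    exact_mod_cast this⟩
  have h4 : p ∣ 1 := by exact_mod_cast h3
  exact hpp.one_lt.ne' (Nat.dvd_one.mp h4)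

theorem e8trans {q : ℕ} (h8 : 8 ∣ q) (hq : 8 < q) {g g' : ℕ → VV (Fin q)}
    (hO : Orth (BF (Fin q)) g 8) (hS : Sat8 (L1 (Fin q) : Set (VV (Fin q))) g)
    (hO' : Orth (BF (Fin q)) g' 8) (hS' : Sat8 (L1 (Fin q) : Set (VV (Fin q))) g') :
    ∃ (φ : VV (Fin q) ≃ₗ[ℚ] VV (Fin q)),
      IsIso (BF (Fin q)) (L1 (Fin q)) (BF (Fin q)) (L1 (Fin q)) φ ∧
      ∀ i < 8, φ (g i) = g' i := by
  have h8' : 8 ∣ Fintype.card (Fin q) := by simpa using h8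
  obtain ⟨φ, hφ, hφg, hL, hz, hn, hd, h1⟩ := e8norm h8 hq hO hS
  obtain ⟨ψ, hψ, hψg, kL, kz, kn, kd, k1⟩ := e8norm h8 hq hO' hS'
  obtain ⟨χ, hχ, hχe, hχv⟩ := eichV h8' _ hd h1 kd k1
    ⟨by
      have := (L1 (Fin q)).sub_mem hL kL
      simpa using this, fun i hi => by simp [hz i hi, kz i hi]⟩ (by rw [hn, kn])
  refine ⟨(φ.trans χ).trans ψ.symm, (hφ.trans hχ).trans hψ.symm, fun i hi => ?_⟩
  simp only [LinearEquiv.trans_apply]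
  rw [LinearEquiv.symm_apply_eq]
  rcases Nat.lt_succ_iff_lt_or_eq.mp hi with hi7 | rfl
  · rw [hφg i hi7, hψg i hi7, epsN_eq (by omega : i < q)]
    exact hχe ⟨i, _⟩ hi7
  · rw [map_smul] at hχv
    exact smul_right_injective _ (by norm_num : (1 / 2 : ℚ) ≠ 0) hχv

end E8

section Models

/-- Orthogonal sum of a negative definite space and a given space. -/
def BP (ι : Type) [Fintype ι] {W : Type*} (B : W → W → ℚ) (x y : (ι → ℚ) × W) : ℚ :=
  B x.2 y.2 - ∑ i, x.1 i * y.1 i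

/-- Orthogonal sum of `D_n⁺` and a given lattice. -/
def LP (ι : Type) [Fintype ι] {W : Type*} (L : Set W) : Set ((ι → ℚ) × W) :=
  {x | x.1 ∈ Dp ι ∧ x.2 ∈ L}

theorem ext_iso (ι : Type) [Fintype ι] {V W : Type*} [AddCommGroup V] [Module ℚ V]
    [AddCommGroup W] [Module ℚ W]
    {B : V → V → ℚ} {L : Set V} {B' : W → W → ℚ} {L' : Set W} {φ : V ≃ₗ[ℚ] W}
    (h : IsIso B L B' L' φ) :
    IsIso (BP ι B) (LP ι L) (BP ι B') (LP ι L')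
      ((LinearEquiv.refl ℚ (ι → ℚ)).prodCongr φ) := by
  refine ⟨fun x y => ?_, fun x => ?_⟩
  · simp [BP, h.1]
  · simp [LP, h.2]

theorem reindex_iso {ι κ : Type} [Fintype ι] [Fintype κ] (e : ι ≃ κ) :
    IsIso (BF κ) (L1 κ) (BF ι) (L1 ι)
      ((LinearEquiv.refl ℚ (Fin 4 → ℚ)).prodCongr (LinearEquiv.funCongrLeft ℚ ℚ e)) := by
  refine ⟨fun x y => ?_, fun x => ?_⟩
  · simp only [BF, BV_apply, LinearEquiv.prodCongr_apply, LinearEquiv.refl_apply]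
    congr 1
    exact Equiv.sum_comp e (fun i => x.2 i * y.2 i)
  · simp only [SetLike.mem_coe, mem_L1, mem_Dp, LinearEquiv.prodCongr_apply,
      LinearEquiv.refl_apply]
    have e1 : ∑ i, (LinearEquiv.funCongrLeft ℚ ℚ e) x.2 i = ∑ i, x.2 i :=
      Equiv.sum_comp e (fun i => x.2 i)
    rw [e1]
    refine and_congr_right fun _ => and_congr_left fun _ => or_congr ?_ ?_
    · exact e.forall_congr_left (p := fun i => ZZ (x.2 (e i))) |>.trans (by simp)
    · exact e.forall_congr_left (p := fun i => ZZ (x.2 (e i) - 1 / 2)) |>.trans (by simp)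

variable {ι κ : Type} [Fintype ι] [Fintype κ] [DecidableEq ι] [DecidableEq κ]

/-- The auxiliary functional of the neighbour map. -/
def nbA (x : VV (ι ⊕ κ)) : ℚ := 2 * x.1 0 + 2 * x.1 1 - ∑ i : ι, x.2 (Sum.inl i)

/-- The neighbour map. -/
def nb (i0 : ι) (k0 : κ) : VV (ι ⊕ κ) →ₗ[ℚ] (ι → ℚ) × VV κ where
  toFun x := (fun i => x.2 (Sum.inl i) - x.1 0 / 2 + (if i = i0 then nbA x else 0),
    (![nbA x, nbA x + x.2 (Sum.inl i0) + x.2 (Sum.inr k0), x.1 2, x.1 3],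
      fun k => x.2 (Sum.inr k) + (if k = k0 then nbA x else 0)))
  map_add' x y := by
    have hA : nbA (x + y) = nbA x + nbA y := by
      simp [nbA, Finset.sum_add_distrib]; ring
    rw [hA]
    refine Prod.ext (funext fun i => ?_) (Prod.ext (funext fun i => ?_) (funext fun i => ?_))
    · by_cases h : i = i0 <;> simp [h] <;> ring
    · fin_cases i <;> simp <;> ring
    · by_cases h : i = k0 <;> simp [h] <;> ring
  map_smul' c x := by
    have hA : nbA (c • x) = c * nbA x := by
      simp [nbA, ← Finset.mul_sum]; ring
    rw [hA]
    refine Prod.ext (funext fun i => ?_) (Prod.ext (funext fun i => ?_) (funext fun i => ?_))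
    · by_cases h : i = i0 <;> simp [h] <;> ring
    · fin_cases i <;> simp <;> ring
    · by_cases h : i = k0 <;> simp [h] <;> ring

theorem nb_isom (h8 : Fintype.card ι = 8) (i0 : ι) (k0 : κ) (x y : VV (ι ⊕ κ)) :
    BP ι (BF κ) (nb i0 k0 x) (nb i0 k0 y) = BF (ι ⊕ κ) x y := by
  have e1 : ∑ i : ι, (nb i0 k0 x).1 i * (nb i0 k0 y).1 i =
      ∑ i : ι, x.2 (Sum.inl i) * y.2 (Sum.inl i)
      - y.1 0 / 2 * ∑ i : ι, x.2 (Sum.inl i) - x.1 0 / 2 * ∑ i : ι, y.2 (Sum.inl i)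
      + 2 * x.1 0 * y.1 0 + nbA x * nbA y
      + nbA x * (y.2 (Sum.inl i0) - y.1 0 / 2) + nbA y * (x.2 (Sum.inl i0) - x.1 0 / 2) := by
    have : ∀ i : ι, (nb i0 k0 x).1 i * (nb i0 k0 y).1 i =
        x.2 (Sum.inl i) * y.2 (Sum.inl i)
        - y.1 0 / 2 * x.2 (Sum.inl i) - x.1 0 / 2 * y.2 (Sum.inl i)
        + x.1 0 * y.1 0 / 4 + (if i = i0 then nbA x * nbA y
        + nbA x * (y.2 (Sum.inl i0) - y.1 0 / 2)
        + nbA y * (x.2 (Sum.inl i0) - x.1 0 / 2) else 0) := by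
      intro i
      by_cases h : i = i0
      · subst h; simp [nb]; ring
      · simp [nb, h]; ring
    rw [Finset.sum_congr rfl fun i _ => this i]
    simp only [Finset.sum_add_distrib, Finset.sum_sub_distrib, ← Finset.mul_sum,
      Finset.sum_const, Finset.card_univ, h8, Finset.sum_ite_eq', Finset.mem_univ, if_true]
    simp only [nsmul_eq_mul]; push_cast; ring
  have e2 : ∑ i : κ, (nb i0 k0 x).2.2 i * (nb i0 k0 y).2.2 i =
      ∑ i : κ, x.2 (Sum.inr i) * y.2 (Sum.inr i) + nbA x * nbA y
      + nbA x * y.2 (Sum.inr k0) + nbA y * x.2 (Sum.inr k0) := by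
    have : ∀ i : κ, (nb i0 k0 x).2.2 i * (nb i0 k0 y).2.2 i =
        x.2 (Sum.inr i) * y.2 (Sum.inr i) + (if i = k0 then nbA x * nbA y
        + nbA x * y.2 (Sum.inr k0) + nbA y * x.2 (Sum.inr k0) else 0) := by
      intro i
      by_cases h : i = k0
      · subst h; simp [nb]; ring
      · simp [nb, h]
    rw [Finset.sum_congr rfl fun i _ => this i]
    simp only [Finset.sum_add_distrib, Finset.sum_ite_eq', Finset.mem_univ, if_true]
    ring
  have e3 : UForm (nb i0 k0 x).2.1 (nb i0 k0 y).2.1 =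
      nbA x * (nbA y + y.2 (Sum.inl i0) + y.2 (Sum.inr k0)) +
      (nbA x + x.2 (Sum.inl i0) + x.2 (Sum.inr k0)) * nbA y + x.1 2 * y.1 3 + x.1 3 * y.1 2 := rfl
  rw [BP, BF, BF, BV_apply, BV_apply, e1, e2, e3, Fintype.sum_sum_type, UForm]
  have hx : ∑ i : ι, x.2 (Sum.inl i) = 2 * x.1 0 + 2 * x.1 1 - nbA x := by rw [nbA]; ring
  have hy : ∑ i : ι, y.2 (Sum.inl i) = 2 * y.1 0 + 2 * y.1 1 - nbA y := by rw [nbA]; ring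
  rw [hx, hy]; ring

theorem nb_mem (h8 : Fintype.card ι = 8) (i0 : ι) (k0 : κ) {x : VV (ι ⊕ κ)}
    (hx : x ∈ L1 (ι ⊕ κ)) : nb i0 k0 x ∈ LP ι (L1 κ : Set (VV κ)) := by
  obtain ⟨hx1, hx2, s, hs⟩ := hx
  rw [Fintype.sum_sum_type] at hs
  have hS : ZZ (∑ i : ι, x.2 (Sum.inl i)) := by
    rcases hx2 with h | h
    · exact ZZ.sum _ _ fun i _ => h _
    · have h1 : ZZ (∑ i : ι, (x.2 (Sum.inl i) - 1 / 2)) := ZZ.sum _ _ fun i _ => h _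
      have h2 := h1.add (ZZ.int 4)
      rw [Finset.sum_sub_distrib, Finset.sum_const, Finset.card_univ, h8] at h2
      norm_num at h2
      exact h2
  have hA : ZZ (nbA x) :=
    (((ZZ.int 2).mul (hx1 0)).add ((ZZ.int 2).mul (hx1 1))).sub hS
  have hx0 : ∀ (z : ℚ) (p : Prop) [Decidable p], ZZ z → ZZ (if p then z else 0) := by
    intro z p _ h
    by_cases hp : p
    · simpa [hp] using h
    · simpa [hp] using ZZ.zero
  refine ⟨⟨?_, ?_⟩, ?_, ?_, ?_⟩
  · obtain ⟨a, ha⟩ := hx1 0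
    rcases Int.even_or_odd' a with ⟨b, hb | hb⟩
    · have e : x.1 0 / 2 = b := by rw [ha, hb]; push_cast; ring
      rcases hx2 with h | h
      · refine Or.inl fun i => ((h (Sum.inl i)).sub ⟨b, e⟩).add (hx0 _ _ hA)
      · refine Or.inr fun i => ?_
        have := ((h (Sum.inl i)).sub ⟨b, e⟩).add (hx0 _ (i = i0) hA)
        convert this using 1
        simp only [nb, LinearMap.coe_mk, AddHom.coe_mk]; ring
    · have e : x.1 0 / 2 - 1 / 2 = b := by rw [ha, hb]; push_cast; ring
      rcases hx2 with h | h
      · refine Or.inr fun i => ?_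
        have := (((h (Sum.inl i)).sub ⟨b, e⟩).add (hx0 _ (i = i0) hA)).sub ZZ.one
        convert this using 1
        simp only [nb, LinearMap.coe_mk, AddHom.coe_mk]; ring
      · refine Or.inl fun i => ?_
        have := ((h (Sum.inl i)).sub ⟨b, e⟩).add (hx0 _ (i = i0) hA)
        convert this using 1
        simp only [nb, LinearMap.coe_mk, AddHom.coe_mk]; ring
  · obtain ⟨a, ha⟩ := hx1 0
    obtain ⟨b, hb⟩ := hx1 1
    refine ⟨b - a, ?_⟩
    simp only [nb, LinearMap.coe_mk, AddHom.coe_mk, Finset.sum_add_distrib,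
      Finset.sum_sub_distrib, Finset.sum_const, Finset.card_univ, h8, Finset.sum_ite_eq',
      Finset.mem_univ, if_true, nbA, ha, hb]
    simp only [nsmul_eq_mul]; push_cast; ring
  · have h1 : ZZ (x.2 (Sum.inl i0) + x.2 (Sum.inr k0)) := by
      rcases hx2 with h | h
      · exact (h _).add (h _)
      · have := ((h (Sum.inl i0)).add (h (Sum.inr k0))).add ZZ.one
        convert this using 1
        ring
    intro i
    fin_cases i
    · exact hA
    · have := hA.add h1
      rw [← add_assoc] at this
      exact this
    · exact hx1 2
    · exact hx1 3
  · rcases hx2 with h | h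
    · exact Or.inl fun k => (h (Sum.inr k)).add (hx0 _ _ hA)
    · refine Or.inr fun k => ?_
      have := (h (Sum.inr k)).add (hx0 _ (k = k0) hA)
      convert this using 1
      simp only [nb, LinearMap.coe_mk, AddHom.coe_mk]; ring
  · obtain ⟨a, ha⟩ := hx1 0
    obtain ⟨b, hb⟩ := hx1 1
    obtain ⟨c, hc⟩ := hS
    refine ⟨s - c + a + b, ?_⟩
    simp only [nb, LinearMap.coe_mk, AddHom.coe_mk, Finset.sum_add_distrib,
      Finset.sum_ite_eq', Finset.mem_univ, if_true, nbA, ha, hb]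
    rw [hc] at hs ⊢
    push_cast; linarith

theorem LP_int (h8 : 8 ∣ Fintype.card ι) (k8 : 8 ∣ Fintype.card κ) {x y : (ι → ℚ) × VV κ}
    (hx : x ∈ LP ι (L1 κ : Set (VV κ))) (hy : y ∈ LP ι (L1 κ : Set (VV κ))) :
    ZZ (BP ι (BF κ) x y) := by
  have h1 := L1_int h8 (0, x.1) ⟨fun _ => ZZ.zero, hx.1⟩ (0, y.1) ⟨fun _ => ZZ.zero, hy.1⟩
  have h2 := L1_int k8 _ hx.2 _ hy.2
  have := h2.add h1
  convert this using 1
  simp [BP, BV_apply, UForm]; ring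

theorem nb_iso (h8 : Fintype.card ι = 8) (k8 : 8 ∣ Fintype.card κ) (i0 : ι) (k0 : κ) :
    ∃ φ : VV (ι ⊕ κ) ≃ₗ[ℚ] (ι → ℚ) × VV κ,
      IsIso (BF (ι ⊕ κ)) (L1 (ι ⊕ κ)) (BP ι (BF κ)) (LP ι (L1 κ : Set (VV κ))) φ := by
  have hinj : Function.Injective (nb i0 k0 : VV (ι ⊕ κ) →ₗ[ℚ] (ι → ℚ) × VV κ) := by
    rw [injective_iff_map_eq_zero]
    intro x hx
    refine BV_nondeg fun y => ?_
    have := nb_isom h8 i0 k0 x y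
    rw [hx] at this
    change _ = BV _ x y at this
    rw [← this]
    simp [BP, BF]
  have hfr : Module.finrank ℚ (VV (ι ⊕ κ)) = Module.finrank ℚ ((ι → ℚ) × VV κ) := by
    simp [Module.finrank_prod]; ring
  let φ := LinearMap.linearEquivOfInjective (nb i0 k0) hinj hfr
  have hφ : ∀ x, φ x = nb i0 k0 x := fun x => rfl
  have c8 : 8 ∣ Fintype.card (ι ⊕ κ) := by
    rw [Fintype.card_sum, h8]; exact dvd_add dvd_rfl k8
  refine ⟨φ, fun x y => ?_, fun x => ⟨fun hx => ?_, fun hx => ?_⟩⟩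
  · rw [hφ, hφ, nb_isom h8]
  · refine L1_unimod c8 fun y hy => ?_
    have := LP_int ⟨1, by simp [h8]⟩ k8 hx (nb_mem h8 i0 k0 hy)
    rw [hφ, nb_isom h8] at this
    exact this
  · rw [hφ]; exact nb_mem h8 i0 k0 hx

theorem E8Set_eq (x : Fin 8 → ℚ) : x ∈ E8Set ↔ x ∈ Dp (Fin 8) := Iff.rfl

/-- Reshape the ambient space. -/
def reshape : ((Fin 8 → ℚ) × ((Fin 8 → ℚ) × VV (Fin 8))) ≃ₗ[ℚ] IIAmb 3 where
  toFun x := (x.2.2.1, ![x.1, x.2.1, x.2.2.2])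
  invFun z := (z.2 0, (z.2 1, (z.1, z.2 2)))
  map_add' x y := by
    refine Prod.ext rfl (funext fun i => ?_)
    fin_cases i <;> rfl
  map_smul' x y := by
    refine Prod.ext rfl (funext fun i => ?_)
    fin_cases i <;> rfl
  left_inv x := rfl
  right_inv z := by
    refine Prod.ext rfl (funext fun i => ?_)
    fin_cases i <;> rfl

theorem reshape_iso : IsIso (BP (Fin 8) (BP (Fin 8) (BF (Fin 8))))
    (LP (Fin 8) (LP (Fin 8) (L1 (Fin 8) : Set (VV (Fin 8))))) (IIForm 3) (IISet 3) reshape := by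
  refine ⟨fun x y => ?_, fun x => ?_⟩
  · simp only [IIForm, BP, BF, BV_apply, negE, Fin.sum_univ_three]
    change UForm x.2.2.1 y.2.2.1 + (-∑ i, x.1 i * y.1 i + -∑ i, x.2.1 i * y.2.1 i +
      -∑ i, x.2.2.2 i * y.2.2.2 i) = _
    ring
  · constructor
    · rintro ⟨h1, h2⟩
      exact ⟨h2 0, h2 1, h1, h2 2⟩
    · rintro ⟨h0, h1, h, h2⟩
      refine ⟨h, fun j => ?_⟩
      fin_cases j
      · exact h0
      · exact h1
      · exact h2

theorem theta16 (q : ℕ) (hq : q = 16) : ∃ Θ : ((Fin 8 → ℚ) × VV (Fin q)) ≃ₗ[ℚ] IIAmb 3,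
    IsIso (BP (Fin 8) (BF (Fin q))) (LP (Fin 8) (L1 (Fin q) : Set (VV (Fin q))))
      (IIForm 3) (IISet 3) Θ := by
  subst hq
  obtain ⟨φ, hφ⟩ := nb_iso (ι := Fin 8) (κ := Fin 8) (by simp) (by simp) 0 0
  have e : Fin 8 ⊕ Fin 8 ≃ Fin 16 := finSumFinEquiv
  exact ⟨_, (ext_iso (Fin 8) ((reindex_iso e).trans hφ)).trans reshape_iso⟩

theorem theta24' (q : ℕ) (hq : q = 24) : ∃ Θ : VV (Fin q) ≃ₗ[ℚ] ((Fin 8 → ℚ) × VV (Fin 16)),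
    IsIso (BF (Fin q)) (L1 (Fin q) : Set (VV (Fin q))) (BP (Fin 8) (BF (Fin 16)))
      (LP (Fin 8) (L1 (Fin 16) : Set (VV (Fin 16)))) Θ := by
  subst hq
  obtain ⟨φ, hφ⟩ := nb_iso (ι := Fin 8) (κ := Fin 16) (by simp) (by simp) 0 0
  have e : Fin 8 ⊕ Fin 16 ≃ Fin 24 := finSumFinEquiv
  exact ⟨_, (reindex_iso e).trans hφ⟩

theorem theta24 (q : ℕ) (hq : q = 24) : ∃ Θ : VV (Fin q) ≃ₗ[ℚ] IIAmb 3,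
    IsIso (BF (Fin q)) (L1 (Fin q) : Set (VV (Fin q))) (IIForm 3) (IISet 3) Θ := by
  obtain ⟨φ, hφ⟩ := theta24' q hq
  obtain ⟨ψ, hψ⟩ := theta16 16 rfl
  exact ⟨_, hφ.trans hψ⟩

end Models

section Assembly

/-- The coordinates of `Λ_N` for `N = n + 2`. -/
def lam (n : ℕ) : (Fin (n + 2 + 2) → ℚ) →ₗ[ℚ] VV (Fin n) where
  toFun x := (fun i => x ⟨i.val, by omega⟩, fun j => x ⟨j.val + 4, by omega⟩)
  map_add' _ _ := rfl
  map_smul' _ _ := rfl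

/-- Inverse coordinates. -/
def lamInv (n : ℕ) (z : VV (Fin n)) : Fin (n + 2 + 2) → ℚ := fun i =>
  if h : i.val < 4 then z.1 ⟨i.val, h⟩ else z.2 ⟨i.val - 4, by omega⟩

theorem lam_lamInv (n : ℕ) (z : VV (Fin n)) : lam n (lamInv n z) = z := by
  refine Prod.ext (funext fun i => ?_) (funext fun j => ?_)
  · simp [lam, lamInv]
  · simp [lam, lamInv]

theorem lam_inj (n : ℕ) : Function.Injective (lam n) := by
  intro x y h
  funext i
  by_cases hi : i.val < 4
  · exact congrFun (congrArg Prod.fst h) ⟨i.val, hi⟩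
  · have := congrFun (congrArg Prod.snd h) ⟨i.val - 4, by omega⟩
    simp only [lam, LinearMap.coe_mk, AddHom.coe_mk] at this
    have e : (⟨i.val - 4 + 4, by omega⟩ : Fin (n + 2 + 2)) = i := Fin.ext (by simp; omega)
    rwa [e] at this

theorem sum_lam (n : ℕ) (f : Fin (n + 2 + 2) → ℚ) :
    (∑ i : Fin (n + 2 + 2), if 4 ≤ (i : ℕ) then f i else 0) =
      ∑ j : Fin n, f ⟨j.val + 4, by omega⟩ := by
  rw [← (finCongr (show 4 + n = n + 2 + 2 by omega)).sum_comp, Fin.sum_univ_add,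
    Finset.sum_eq_zero, zero_add]
  · refine Finset.sum_congr rfl fun j _ => ?_
    rw [if_pos (by simp)]
    congr 1
    exact Fin.ext (by simp [add_comm])
  · intro i _
    rw [if_neg (by simp)]

theorem lam_form (n : ℕ) (x y) : BF (Fin n) (lam n x) (lam n y) = LamForm (n + 2) x y := by
  rw [LamForm, sum_lam n (fun i => x i * y i)]
  rfl

/-- The lattice `U² ⊕ D_n`. -/
def LD (n : ℕ) : Set (VV (Fin n)) := {z | (∀ i, ZZ (z.1 i)) ∧ z.2 ∈ DSet n}

theorem lam_mem (n : ℕ) (x) : lam n x ∈ LD n ↔ x ∈ LamSet (n + 2) := by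
  constructor
  · rintro ⟨h1, h2, h3⟩
    refine ⟨fun i => ?_, by rw [sum_lam]; exact h3⟩
    by_cases hi : i.val < 4
    · exact h1 ⟨i.val, hi⟩
    · have := h2 ⟨i.val - 4, by omega⟩
      simp only [lam, LinearMap.coe_mk, AddHom.coe_mk] at this
      have e : (⟨i.val - 4 + 4, by omega⟩ : Fin (n + 2 + 2)) = i := Fin.ext (by simp; omega)
      rwa [e] at this
  · rintro ⟨h1, h2⟩
    rw [sum_lam] at h2
    exact ⟨fun i => h1 _, fun i => h1 _, h2⟩

/-- Mutually orthogonal complements. -/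
structure Split {V A C : Type*} [AddCommGroup V] [Module ℚ V] [AddCommGroup A] [Module ℚ A]
    [AddCommGroup C] [Module ℚ C] (B : V → V → ℚ) (L : Set V)
    (a : A →ₗ[ℚ] V) (SA : Set A) (b : C →ₗ[ℚ] V) (SC : Set C) : Prop where
  ma : ∀ x, a x ∈ L ↔ x ∈ SA
  mb : ∀ x, b x ∈ L ↔ x ∈ SC
  oa : ∀ z, (∀ x, B z (a x) = 0) ↔ ∃ y, b y = z
  ob : ∀ z, (∀ y, B z (b y) = 0) ↔ ∃ x, a x = z
  ia : Function.Injective a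
  ib : Function.Injective b

section
variable {V A C : Type*} [AddCommGroup V] [Module ℚ V] [AddCommGroup A] [Module ℚ A]
    [AddCommGroup C] [Module ℚ C] {B : V → V → ℚ} {L : Set V}
    {a : A →ₗ[ℚ] V} {SA : Set A} {b : C →ₗ[ℚ] V} {SC : Set C}

theorem Split.swap (h : Split B L a SA b SC) : Split B L b SC a SA :=
  ⟨h.mb, h.ma, h.ob, h.oa, h.ib, h.ia⟩

theorem Split.image (h : Split B L a SA b SC) :
    b '' SC = {z | z ∈ L ∧ ∀ x, B z (a x) = 0} := by
  ext z
  simp only [Set.mem_ofPred_eq, h.oa]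
  constructor
  · rintro ⟨y, hy, rfl⟩
    exact ⟨(h.mb y).2 hy, y, rfl⟩
  · rintro ⟨hz, y, rfl⟩
    exact ⟨y, (h.mb y).1 hz, rfl⟩

theorem Split.map {W : Type*} [AddCommGroup W] [Module ℚ W] {B' : W → W → ℚ} {L' : Set W}
    (h : Split B L a SA b SC) {Φ : V ≃ₗ[ℚ] W} (hΦ : IsIso B L B' L' Φ) :
    Split B' L' (Φ.toLinearMap ∘ₗ a) SA (Φ.toLinearMap ∘ₗ b) SC where
  ma x := by simp [hΦ.2, h.ma]
  mb x := by simp [hΦ.2, h.mb]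
  oa z := by
    obtain ⟨z, rfl⟩ := Φ.surjective z
    simp [hΦ.1, h.oa]
  ob z := by
    obtain ⟨z, rfl⟩ := Φ.surjective z
    simp [hΦ.1, h.ob]
  ia := Φ.injective.comp h.ia
  ib := Φ.injective.comp h.ib

/-- Precompose the second map with the coordinates of `Λ_N`. -/
theorem Split.lam {n : ℕ} {b : VV (Fin n) →ₗ[ℚ] V} (h : Split B L a SA b (LD n)) :
    Split B L a SA (b ∘ₗ lam n) (LamSet (n + 2)) where
  ma := h.ma
  mb x := by simp [h.mb, lam_mem]
  oa z := by
    rw [h.oa]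
    constructor
    · rintro ⟨y, rfl⟩
      exact ⟨lamInv n y, by simp [lam_lamInv]⟩
    · rintro ⟨y, rfl⟩
      exact ⟨_, rfl⟩
  ob z := by
    rw [← h.ob]
    constructor
    · intro k y
      have := k (lamInv n y)
      simpa [lam_lamInv] using this
    · intro k y
      exact k _
  ia := h.ia
  ib := h.ib.comp (lam_inj n)
end

/-- First coordinates. -/
def iD (m n : ℕ) : (Fin m → ℚ) →ₗ[ℚ] VV (Fin (m + n)) where
  toFun c := (0, Fin.append c 0)
  map_add' x y := by
    refine Prod.ext (by simp) (funext fun i => ?_)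
    refine Fin.addCases (fun j => ?_) (fun j => ?_) i <;> simp
  map_smul' x y := by
    refine Prod.ext (by simp) (funext fun i => ?_)
    refine Fin.addCases (fun j => ?_) (fun j => ?_) i <;> simp

/-- Last coordinates. -/
def iL (m n : ℕ) : VV (Fin n) →ₗ[ℚ] VV (Fin (m + n)) where
  toFun z := (z.1, Fin.append 0 z.2)
  map_add' x y := by
    refine Prod.ext (by simp) (funext fun i => ?_)
    refine Fin.addCases (fun j => ?_) (fun j => ?_) i <;> simp
  map_smul' x y := by
    refine Prod.ext (by simp) (funext fun i => ?_)
    refine Fin.addCases (fun j => ?_) (fun j => ?_) i <;> simp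

theorem iD_fst (m n : ℕ) (c) : (iD m n c).1 = 0 := rfl
theorem iD_l (m n : ℕ) (c i) : (iD m n c).2 (Fin.castAdd n i) = c i := Fin.append_left _ _ _
theorem iD_r (m n : ℕ) (c i) : (iD m n c).2 (Fin.natAdd m i) = 0 := Fin.append_right _ _ _
theorem iL_fst (m n : ℕ) (z) : (iL m n z).1 = z.1 := rfl
theorem iL_l (m n : ℕ) (z i) : (iL m n z).2 (Fin.castAdd n i) = 0 := Fin.append_left _ _ _
theorem iL_r (m n : ℕ) (z i) : (iL m n z).2 (Fin.natAdd m i) = z.2 i := Fin.append_right _ _ _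

theorem BF_add (m n : ℕ) (x y : VV (Fin (m + n))) : BF (Fin (m + n)) x y =
    UForm x.1 y.1 - (∑ i, x.2 (Fin.castAdd n i) * y.2 (Fin.castAdd n i) +
      ∑ i, x.2 (Fin.natAdd m i) * y.2 (Fin.natAdd m i)) := by
  rw [BF, BV_apply, Fin.sum_univ_add]

theorem iD_isom (m n : ℕ) (x y) : BF (Fin (m + n)) (iD m n x) (iD m n y) = negE x y := by
  simp [BF_add, iD_l, iD_r, iD_fst, UForm, negE]

theorem iL_isom (m n : ℕ) (x y) : BF (Fin (m + n)) (iL m n x) (iL m n y) = BF (Fin n) x y := by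
  rw [BF_add]
  simp [iL_l, iL_r, iL_fst, BV_apply]

theorem Dp_zero {ι : Type} [Fintype ι] {x : ι → ℚ} {i0 : ι} (h : x i0 = 0) :
    x ∈ Dp ι ↔ (∀ i, ZZ (x i)) ∧ ∃ a : ℤ, ∑ i, x i = 2 * (a : ℚ) := by
  rw [mem_Dp]
  refine and_congr_left fun _ => ⟨fun k => ?_, Or.inl⟩
  rcases k with k | k
  · exact k
  · have := k i0
    rw [h] at this
    exact absurd this not_ZZ_half'

theorem split1 (m n : ℕ) (hm : 1 ≤ m) (hn : 1 ≤ n) :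
    Split (BF (Fin (m + n))) (L1 (Fin (m + n)) : Set (VV (Fin (m + n))))
      (iD m n) (DSet m) (iL m n) (LD n) where
  ma x := by
    rw [SetLike.mem_coe, mem_L1, Dp_zero (iD_r m n x ⟨0, hn⟩), Fin.sum_univ_add]
    simp only [iD_l, iD_r, iD_fst, Finset.sum_const_zero, add_zero]
    constructor
    · rintro ⟨_, h1, h2⟩
      refine ⟨fun i => ?_, h2⟩
      have := h1 (Fin.castAdd n i)
      rwa [iD_l] at this
    · rintro ⟨h1, h2⟩
      refine ⟨fun _ => ZZ.zero, fun i => ?_, h2⟩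
      refine Fin.addCases (fun j => ?_) (fun j => ?_) i
      · rw [iD_l]; exact h1 j
      · rw [iD_r]; exact ZZ.zero
  mb x := by
    rw [SetLike.mem_coe, mem_L1, Dp_zero (iL_l m n x ⟨0, hm⟩), Fin.sum_univ_add]
    simp only [iL_l, iL_r, iL_fst, Finset.sum_const_zero, zero_add]
    constructor
    · rintro ⟨h0, h1, h2⟩
      refine ⟨h0, fun i => ?_, h2⟩
      have := h1 (Fin.natAdd m i)
      rwa [iL_r] at this
    · rintro ⟨h0, h1, h2⟩
      refine ⟨h0, fun i => ?_, h2⟩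
      refine Fin.addCases (fun j => ?_) (fun j => ?_) i
      · rw [iL_l]; exact ZZ.zero
      · rw [iL_r]; exact h1 j
  oa z := by
    constructor
    · intro h
      refine ⟨(z.1, fun i => z.2 (Fin.natAdd m i)), Prod.ext rfl (funext fun i => ?_)⟩
      refine Fin.addCases (fun j => ?_) (fun j => ?_) i
      · rw [iL_l]
        have := h (Pi.single j 1)
        simp only [BF_add, iD_l, iD_r, iD_fst] at this
        simpa [UForm, Pi.single_apply, eq_comm] using this
      · rw [iL_r]
    · rintro ⟨y, rfl⟩ x
      simp [BF_add, iL_l, iL_r, iD_l, iD_r, iL_fst, iD_fst, UForm]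
  ob z := by
    constructor
    · intro h
      have h1 : ∀ u, UForm z.1 u = 0 := by
        intro u
        have := h (u, 0)
        simp only [BF_add, iL_l, iL_r, iL_fst] at this
        simpa using this
      refine ⟨fun i => z.2 (Fin.castAdd n i), Prod.ext ?_ (funext fun i => ?_)⟩
      · rw [iD_fst]
        have e0 := h1 (Pi.single 1 1)
        have e1 := h1 (Pi.single 0 1)
        have e2 := h1 (Pi.single 3 1)
        have e3 := h1 (Pi.single 2 1)
        simp [UForm] at e0 e1 e2 e3
        funext i
        fin_cases i
        · exact e0.symm
        · exact e1.symm
        · exact e2.symm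
        · exact e3.symm
      · refine Fin.addCases (fun j => ?_) (fun j => ?_) i
        · rw [iD_l]
        · rw [iD_r]
          have := h (0, Pi.single j 1)
          simp only [BF_add, iL_l, iL_r, iL_fst] at this
          simpa [UForm, Pi.single_apply, eq_comm] using this
    · rintro ⟨y, rfl⟩ x
      simp [BF_add, iL_l, iL_r, iD_l, iD_r, iL_fst, iD_fst, UForm]
  ia x y h := by
    funext i
    rw [← iD_l m n x, h, iD_l]
  ib x y h := by
    refine Prod.ext ?_ (funext fun i => ?_)
    · rw [← iL_fst m n x, h, iL_fst]
    · rw [← iL_r m n x, h, iL_r]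

theorem split2 (m n : ℕ) (hm : 1 ≤ m) (hn : 1 ≤ n) :
    Split (BP (Fin 8) (BF (Fin (m + n))))
      (LP (Fin 8) (L1 (Fin (m + n)) : Set (VV (Fin (m + n)))))
      ((LinearMap.id : (Fin 8 → ℚ) →ₗ[ℚ] (Fin 8 → ℚ)).prodMap (iD m n))
      {p | p.1 ∈ E8Set ∧ p.2 ∈ DSet m}
      (LinearMap.inr ℚ (Fin 8 → ℚ) (VV (Fin (m + n))) ∘ₗ iL m n) (LD n) where
  ma x := and_congr Iff.rfl ((split1 m n hm hn).ma x.2)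
  mb x := by
    rw [← (split1 m n hm hn).mb x]
    exact ⟨fun h => h.2, fun h => ⟨(Dp (Fin 8)).zero_mem, h⟩⟩
  oa z := by
    constructor
    · intro h
      obtain ⟨y, hy⟩ := ((split1 m n hm hn).oa z.2).1 fun x => by
        have := h (0, x)
        simpa [BP] using this
      refine ⟨y, Prod.ext (funext fun i => ?_) hy⟩
      have := h (Pi.single i 1, 0)
      simp [BP, BF, Pi.single_apply] at this
      simp [this]
    · rintro ⟨y, rfl⟩ x
      have := ((split1 m n hm hn).oa _).2 ⟨y, rfl⟩ x.2
      simpa [BP] using this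
  ob z := by
    constructor
    · intro h
      obtain ⟨y, hy⟩ := ((split1 m n hm hn).ob z.2).1 fun x => by
        have := h x
        simpa [BP] using this
      exact ⟨(z.1, y), Prod.ext rfl hy⟩
    · rintro ⟨y, rfl⟩ x
      have := ((split1 m n hm hn).ob _).2 ⟨y.2, rfl⟩ x
      simpa [BP] using this
  ia x y h := by
    have h1 := congrArg Prod.fst h
    have h2 := congrArg Prod.snd h
    exact Prod.ext h1 ((split1 m n hm hn).ia h2)
  ib x y h := (split1 m n hm hn).ib (congrArg Prod.snd h)

/-- Images of the standard basis, indexed by natural numbers. -/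
def basN {V : Type*} [AddCommGroup V] [Module ℚ V] {m : ℕ} (G : (Fin m → ℚ) →ₗ[ℚ] V) (i : ℕ) : V :=
  if h : i < m then G (Pi.single ⟨i, h⟩ 1) else 0

section
variable {V : Type*} [AddCommGroup V] [Module ℚ V] {m : ℕ}

theorem basN_val (G : (Fin m → ℚ) →ₗ[ℚ] V) (i : Fin m) : basN G i.val = G (Pi.single i 1) := by
  simp [basN]

theorem sum_basN (G : (Fin m → ℚ) →ₗ[ℚ] V) (c : ℕ → ℚ) :
    ∑ i ∈ Finset.range m, c i • basN G i = G (fun i => c i.val) := by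
  rw [Finset.sum_range]
  simp only [basN_val]
  rw [LinearMap.pi_apply_eq_sum_univ G (fun i => c i.val)]
  refine Finset.sum_congr rfl fun i _ => ?_
  congr 2
  funext j
  simp [Pi.single_apply, eq_comm]

theorem lin_eq {F G : (Fin m → ℚ) →ₗ[ℚ] V} (h : ∀ i : Fin m, F (Pi.single i 1) = G (Pi.single i 1)) :
    F = G := by
  refine (Pi.basisFun ℚ (Fin m)).ext fun i => ?_
  simpa using h i

theorem basN_orth {B : V → V → ℚ} {G : (Fin m → ℚ) →ₗ[ℚ] V}
    (h : ∀ x y, B (G x) (G y) = negE x y) : Orth B (basN G) m := by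
  intro i hi j hj
  have := h (Pi.single ⟨i, hi⟩ 1) (Pi.single ⟨j, hj⟩ 1)
  simp only [basN, hi, hj, dif_pos]
  rw [this]
  by_cases hij : i = j
  · subst hij; simp [negE, Pi.single_apply]
  · simp [negE, Pi.single_apply, hij, Ne.symm hij]

theorem basN_sat {L : Set V} {G : (Fin m → ℚ) →ₗ[ℚ] V}
    (h : ∀ x, G x ∈ L ↔ x ∈ DSet m) : Sat L (basN G) m := by
  intro c
  rw [sum_basN, h, Finset.sum_range]
  exact and_congr_left fun _ => ⟨fun h i hi => h ⟨i, hi⟩, fun h i => h i.val i.isLt⟩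

theorem basN_sat8 {L : Set V} {G : (Fin 8 → ℚ) →ₗ[ℚ] V}
    (h : ∀ x, G x ∈ L ↔ x ∈ Dp (Fin 8)) : Sat8 L (basN G) := by
  intro c
  rw [sum_basN, h]
end

theorem chainG {m n : ℕ} (h8 : 8 ∣ m + n) (hm : 1 ≤ m) (hn : 1 ≤ n)
    (G : (Fin m → ℚ) →ₗ[ℚ] VV (Fin (m + n)))
    (h1 : ∀ x y, BF (Fin (m + n)) (G x) (G y) = negE x y)
    (h2 : ∀ x, G x ∈ (L1 (Fin (m + n)) : Set (VV (Fin (m + n)))) ↔ x ∈ DSet m) :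
    ∃ φ : VV (Fin (m + n)) ≃ₗ[ℚ] VV (Fin (m + n)),
      IsIso (BF (Fin (m + n))) (L1 (Fin (m + n))) (BF (Fin (m + n))) (L1 (Fin (m + n))) φ ∧
      ∀ c, φ (G c) = iD m n c := by
  obtain ⟨φ, hφ, hg⟩ := chain h8 m hm (by omega) _ (basN_orth h1) (basN_sat h2)
  refine ⟨φ, hφ, ?_⟩
  have : φ.toLinearMap ∘ₗ G = iD m n := lin_eq fun i => by
    have := hg i.val i.isLt
    rw [basN_val, epsN_eq (by omega)] at this
    refine this.trans (Prod.ext rfl (funext fun j => ?_))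
    refine Fin.addCases (fun j => ?_) (fun j => ?_) j
    · rw [iD_l]
      simp [eps, Pi.single_apply, Fin.ext_iff]
    · rw [iD_r]
      simp [eps, Pi.single_apply, Fin.ext_iff]
      omega
  intro c
  exact LinearMap.congr_fun this c

theorem part3 {m n : ℕ} (hmn : m + n = 24) (hm : 1 ≤ m) (hn : 1 ≤ n)
    (G : (Fin m → ℚ) →ₗ[ℚ] IIAmb 3)
    (h1 : ∀ x y, IIForm 3 (G x) (G y) = negE x y)
    (h2 : ∀ x, G x ∈ IISet 3 ↔ x ∈ DSet m) :
    ∃ H : (Fin (n + 2 + 2) → ℚ) →ₗ[ℚ] IIAmb 3,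
      Split (IIForm 3) (IISet 3) G (DSet m) H (LamSet (n + 2)) ∧
      ∀ x y, IIForm 3 (H x) (H y) = LamForm (n + 2) x y := by
  obtain ⟨Θ, hΘ⟩ := theta24 (m + n) hmn
  obtain ⟨φ, hφ, hg⟩ := chainG (n := n) ⟨3, hmn⟩ hm hn (Θ.symm.toLinearMap ∘ₗ G)
    (fun x y => by rw [← h1, ← hΘ.1]; simp) (fun x => by rw [← h2, ← hΘ.2]; simp)
  have hΦ := hφ.symm.trans hΘ
  have hs := ((split1 m n hm hn).map hΦ).lam
  have e : (φ.symm.trans Θ).toLinearMap ∘ₗ iD m n = G := by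
    refine LinearMap.ext fun c => ?_
    rw [LinearMap.comp_apply, ← hg c]
    simp
  rw [e] at hs
  refine ⟨_, hs, fun x y => ?_⟩
  rw [← lam_form, ← iL_isom m n]
  exact hΦ.1 _ _

theorem part1 {m n : ℕ} (hmn : m + n = 24) (hm : 1 ≤ m) (hn : 1 ≤ n) :
    ∃ (G : (Fin m → ℚ) →ₗ[ℚ] IIAmb 3) (H : (Fin (n + 2 + 2) → ℚ) →ₗ[ℚ] IIAmb 3),
      Split (IIForm 3) (IISet 3) G (DSet m) H (LamSet (n + 2)) ∧
      (∀ x y, IIForm 3 (G x) (G y) = negE x y) ∧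
      ∀ x y, IIForm 3 (H x) (H y) = LamForm (n + 2) x y := by
  obtain ⟨Θ, hΘ⟩ := theta24 (m + n) hmn
  refine ⟨_, _, ((split1 m n hm hn).map hΘ).lam, fun x y => ?_, fun x y => ?_⟩
  · rw [← iD_isom m n]
    exact hΘ.1 _ _
  · rw [← lam_form, ← iL_isom m n]
    exact hΘ.1 _ _

theorem part2 {m n : ℕ} (hmn : m + n = 16) (hm : 1 ≤ m) (hn : 1 ≤ n) :
    ∃ (G : ((Fin 8 → ℚ) × (Fin m → ℚ)) →ₗ[ℚ] IIAmb 3)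
      (H : (Fin (n + 2 + 2) → ℚ) →ₗ[ℚ] IIAmb 3),
      Split (IIForm 3) (IISet 3) G {p | p.1 ∈ E8Set ∧ p.2 ∈ DSet m} H (LamSet (n + 2)) ∧
      (∀ x y, IIForm 3 (G x) (G y) = negE x.1 y.1 + negE x.2 y.2) ∧
      ∀ x y, IIForm 3 (H x) (H y) = LamForm (n + 2) x y := by
  obtain ⟨Θ, hΘ⟩ := theta16 (m + n) hmn
  refine ⟨_, _, ((split2 m n hm hn).map hΘ).lam, fun x y => ?_, fun x y => ?_⟩
  · rw [← iD_isom m n]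
    refine (hΘ.1 _ _).trans ?_
    simp [BP, negE]; ring
  · rw [← lam_form, ← iL_isom m n]
    refine (hΘ.1 _ _).trans ?_
    simp [BP]

theorem part4 {m n : ℕ} (hmn : m + n = 16) (hm : 1 ≤ m) (hn : 1 ≤ n)
    (G : ((Fin 8 → ℚ) × (Fin m → ℚ)) →ₗ[ℚ] IIAmb 3)
    (h1 : ∀ x y, IIForm 3 (G x) (G y) = negE x.1 y.1 + negE x.2 y.2)
    (h2 : ∀ p, G p ∈ IISet 3 ↔ p.1 ∈ E8Set ∧ p.2 ∈ DSet m) :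
    ∃ H : (Fin (n + 2 + 2) → ℚ) →ₗ[ℚ] IIAmb 3,
      Split (IIForm 3) (IISet 3) G {p | p.1 ∈ E8Set ∧ p.2 ∈ DSet m} H (LamSet (n + 2)) ∧
      ∀ x y, IIForm 3 (H x) (H y) = LamForm (n + 2) x y := by
  have hD0 : (0 : Fin m → ℚ) ∈ DSet m := ⟨fun _ => ZZ.zero, 0, by simp⟩
  have hE0 : (0 : Fin 8 → ℚ) ∈ E8Set := (Dp (Fin 8)).zero_mem
  obtain ⟨Θ, hΘ⟩ := theta16 (m + n) hmn
  obtain ⟨T, hT⟩ := theta24 24 rfl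
  obtain ⟨φ, hφ, hφg⟩ := e8trans (q := 24) ⟨3, rfl⟩ (by norm_num)
    (g := basN (T.symm.toLinearMap ∘ₗ G ∘ₗ LinearMap.inl ℚ (Fin 8 → ℚ) (Fin m → ℚ)))
    (g' := basN (T.symm.toLinearMap ∘ₗ Θ.toLinearMap ∘ₗ
      LinearMap.inl ℚ (Fin 8 → ℚ) (VV (Fin (m + n)))))
    (basN_orth fun x y => by
      have := h1 (x, 0) (y, 0)
      rw [← hT.1]
      simpa [negE] using this)
    (basN_sat8 fun x => by
      have := h2 (x, 0)
      rw [← hT.2]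
      simpa [hD0, E8Set_eq] using this)
    (basN_orth fun x y => by
      have := hΘ.1 (x, 0) (y, 0)
      rw [← hT.1]
      simpa [negE, BP] using this)
    (basN_sat8 fun x => by
      have := hΘ.2 (x, 0)
      rw [← hT.2]
      simpa [LP] using this)
  have hc : ∀ c, φ (T.symm (G (c, 0))) = T.symm (Θ (c, 0)) := by
    have : φ.toLinearMap ∘ₗ (T.symm.toLinearMap ∘ₗ G ∘ₗ
          LinearMap.inl ℚ (Fin 8 → ℚ) (Fin m → ℚ)) =
        (T.symm.toLinearMap ∘ₗ Θ.toLinearMap ∘ₗ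
          LinearMap.inl ℚ (Fin 8 → ℚ) (VV (Fin (m + n)))) := lin_eq fun i => by
      have := hφg i.val i.isLt
      rw [basN_val, basN_val] at this
      exact this
    exact fun c => LinearMap.congr_fun this c
  have hχ := ((hT.symm.trans hφ).trans hT).trans hΘ.symm
  set χ := ((T.symm.trans φ).trans T).trans Θ.symm with hχdef
  have hχc : ∀ c, χ (G (c, 0)) = (c, 0) := by
    intro c
    simp only [hχdef, LinearEquiv.trans_apply, hc]
    simp
  have hχ1 : ∀ d, (χ (G (0, d))).1 = 0 := by
    intro d
    funext i
    have := hχ.1 (G (0, d)) (G (Pi.single i 1, 0))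
    rw [h1, hχc] at this
    simpa [BP, negE, Pi.single_apply] using this
  obtain ⟨ψ, hψ, hψg⟩ := chainG (n := n) ⟨2, hmn⟩ hm hn
    (LinearMap.snd ℚ (Fin 8 → ℚ) (VV (Fin (m + n))) ∘ₗ χ.toLinearMap ∘ₗ G ∘ₗ
      LinearMap.inr ℚ (Fin 8 → ℚ) (Fin m → ℚ))
    (fun x y => by
      have := hχ.1 (G (0, x)) (G (0, y))
      rw [h1] at this
      simpa [BP, hχ1, negE] using this)
    (fun x => by
      have := hχ.2 (G (0, x))
      rw [h2] at this
      simp only [LP, Set.mem_ofPred_eq, hχ1, hE0, true_and] at this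
      rw [← this]
      exact ⟨fun h => ⟨(Dp (Fin 8)).zero_mem, h⟩, fun h => h.2⟩)
  have hΦ := (hχ.trans (ext_iso (Fin 8) hψ)).symm
  have hs := ((split2 m n hm hn).map hΦ).lam
  have e : ((χ.trans ((LinearEquiv.refl ℚ (Fin 8 → ℚ)).prodCongr ψ)).symm).toLinearMap ∘ₗ
      ((LinearMap.id : (Fin 8 → ℚ) →ₗ[ℚ] (Fin 8 → ℚ)).prodMap (iD m n)) = G := by
    refine LinearMap.ext fun p => ?_
    rw [LinearMap.comp_apply, LinearEquiv.coe_coe, LinearEquiv.symm_apply_eq]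
    have e1 : G p = G (p.1, 0) + G (0, p.2) := by rw [← map_add]; simp
    have e2 : χ (G p) = (p.1, (χ (G (0, p.2))).2) := by
      rw [e1, map_add, hχc]
      exact Prod.ext (by simp [hχ1]) (by simp)
    rw [LinearEquiv.trans_apply, e2]
    exact Prod.ext rfl (hψg p.2).symm
  rw [e] at hs
  refine ⟨_, hs, fun x y => ?_⟩
  rw [← lam_form, ← iL_isom m n]
  refine (hΦ.1 _ _).trans ?_
  simp [BP]

end Assembly

/-- Embeddings of `Λ_N` into the even unimodular lattice `II_{2,26} = U² ⊕ E₈³`: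
for `3 ≤ N ≤ 25` there is a saturated (primitive) embedding with orthogonal complement
isomorphic to `D_{26-N}`, and for `3 ≤ N ≤ 17` also one with orthogonal complement
isomorphic to `E₈ ⊕ D_{18-N}`.  Conversely, the orthogonal complement of any saturated
embedding of `D_{26-N}` (resp. `E₈ ⊕ D_{18-N}`) into `II_{2,26}` is isomorphic to
`Λ_N`. -/
theorem statement18 :
    (∀ N : ℕ, 3 ≤ N → N ≤ 25 →
      ∃ F : (Fin (N + 2) → ℚ) →ₗ[ℚ] IIAmb 3,
        Function.Injective F ∧
        (∀ x y, IIForm 3 (F x) (F y) = LamForm N x y) ∧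
        (∀ x ∈ LamSet N, F x ∈ IISet 3) ∧
        (∀ x, F x ∈ IISet 3 → x ∈ LamSet N) ∧
        ∃ G : (Fin (26 - N) → ℚ) →ₗ[ℚ] IIAmb 3,
          Function.Injective G ∧
          (∀ x y, IIForm 3 (G x) (G y) = negE x y) ∧
          G '' DSet (26 - N) = {z | z ∈ IISet 3 ∧ ∀ x, IIForm 3 z (F x) = 0}) ∧
    (∀ N : ℕ, 3 ≤ N → N ≤ 17 →
      ∃ F : (Fin (N + 2) → ℚ) →ₗ[ℚ] IIAmb 3,
        Function.Injective F ∧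
        (∀ x y, IIForm 3 (F x) (F y) = LamForm N x y) ∧
        (∀ x ∈ LamSet N, F x ∈ IISet 3) ∧
        (∀ x, F x ∈ IISet 3 → x ∈ LamSet N) ∧
        ∃ G : ((Fin 8 → ℚ) × (Fin (18 - N) → ℚ)) →ₗ[ℚ] IIAmb 3,
          Function.Injective G ∧
          (∀ x y, IIForm 3 (G x) (G y) = negE x.1 y.1 + negE x.2 y.2) ∧
          G '' {p | p.1 ∈ E8Set ∧ p.2 ∈ DSet (18 - N)} =
            {z | z ∈ IISet 3 ∧ ∀ x, IIForm 3 z (F x) = 0}) ∧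
    (∀ N : ℕ, 3 ≤ N → N ≤ 25 →
      ∀ G : (Fin (26 - N) → ℚ) →ₗ[ℚ] IIAmb 3,
        Function.Injective G →
        (∀ x y, IIForm 3 (G x) (G y) = negE x y) →
        (∀ x ∈ DSet (26 - N), G x ∈ IISet 3) →
        (∀ x, G x ∈ IISet 3 → x ∈ DSet (26 - N)) →
        ∃ H : (Fin (N + 2) → ℚ) →ₗ[ℚ] IIAmb 3,
          Function.Injective H ∧
          (∀ x y, IIForm 3 (H x) (H y) = LamForm N x y) ∧
          H '' LamSet N = {z | z ∈ IISet 3 ∧ ∀ x, IIForm 3 z (G x) = 0}) ∧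
    (∀ N : ℕ, 3 ≤ N → N ≤ 17 →
      ∀ G : ((Fin 8 → ℚ) × (Fin (18 - N) → ℚ)) →ₗ[ℚ] IIAmb 3,
        Function.Injective G →
        (∀ x y, IIForm 3 (G x) (G y) = negE x.1 y.1 + negE x.2 y.2) →
        (∀ p : (Fin 8 → ℚ) × (Fin (18 - N) → ℚ),
          p.1 ∈ E8Set → p.2 ∈ DSet (18 - N) → G p ∈ IISet 3) →
        (∀ p : (Fin 8 → ℚ) × (Fin (18 - N) → ℚ),
          G p ∈ IISet 3 → p.1 ∈ E8Set ∧ p.2 ∈ DSet (18 - N)) →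
        ∃ H : (Fin (N + 2) → ℚ) →ₗ[ℚ] IIAmb 3,
          Function.Injective H ∧
          (∀ x y, IIForm 3 (H x) (H y) = LamForm N x y) ∧
          H '' LamSet N = {z | z ∈ IISet 3 ∧ ∀ x, IIForm 3 z (G x) = 0}) := by
  refine ⟨?_, ?_, ?_, ?_⟩
  · intro N h3 h25
    obtain ⟨n, rfl⟩ : ∃ n, N = n + 2 := ⟨N - 2, by omega⟩
    obtain ⟨G, H, hs, hG, hH⟩ := part1 (m := 26 - (n + 2)) (n := n)
      (by omega) (by omega) (by omega)
    exact ⟨H, hs.ib, hH, fun x => (hs.mb x).2, fun x => (hs.mb x).1, G, hs.ia, hG, hs.swap.image⟩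
  · intro N h3 h17
    obtain ⟨n, rfl⟩ : ∃ n, N = n + 2 := ⟨N - 2, by omega⟩
    obtain ⟨G, H, hs, hG, hH⟩ := part2 (m := 18 - (n + 2)) (n := n)
      (by omega) (by omega) (by omega)
    exact ⟨H, hs.ib, hH, fun x => (hs.mb x).2, fun x => (hs.mb x).1, G, hs.ia, hG, hs.swap.image⟩
  · intro N h3 h25 G _ h1 h2 h2'
    obtain ⟨n, rfl⟩ : ∃ n, N = n + 2 := ⟨N - 2, by omega⟩
    obtain ⟨H, hs, hH⟩ := part3 (m := 26 - (n + 2)) (n := n)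
      (by omega) (by omega) (by omega) G h1 (fun x => ⟨h2' x, h2 x⟩)
    exact ⟨H, hs.ib, hH, hs.image⟩
  · intro N h3 h17 G _ h1 h2 h2'
    obtain ⟨n, rfl⟩ : ∃ n, N = n + 2 := ⟨N - 2, by omega⟩
    obtain ⟨H, hs, hH⟩ := part4 (m := 18 - (n + 2)) (n := n)
      (by omega) (by omega) (by omega) G h1 (fun x => ⟨h2' x, fun h => h2 x h.1 h.2⟩)
    exact ⟨H, hs.ib, hH, hs.image⟩
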